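/- arXiv:1703.04167 — 4 statements merged into one kernel-verified Lean document; each statement's English description precedes it below -/
import Mathlib

section
/- Let R = ℤ[u,v,w,x,y,z] and I = (Δ1, Δ2, Δ3) the ideal of size-2 minors of the generic 2×3 matrix. The local cohomology module H³_I(R) is a rational vector space: multiplication by n on H³_I(R) is bijective for every nonzero integer n (equivalently, H³_I(R) is a uniquely divisible abelian group, hence carries a ℚ-vector space structure). -/
open MvPolynomial

noncomputable def U : MvPolynomial (Fin 6) ℤ := X 0
noncomputable def V : MvPolynomial (Fin 6) ℤ := X 1
noncomputable def W : MvPolynomial (Fin 6) ℤ := X 2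
noncomputable def Xx : MvPolynomial (Fin 6) ℤ := X 3
noncomputable def Yy : MvPolynomial (Fin 6) ℤ := X 4
noncomputable def Zz : MvPolynomial (Fin 6) ℤ := X 5

noncomputable def Δ1 : MvPolynomial (Fin 6) ℤ := V * Zz - W * Yy
noncomputable def Δ2 : MvPolynomial (Fin 6) ℤ := W * Xx - U * Zz
noncomputable def Δ3 : MvPolynomial (Fin 6) ℤ := U * Yy - V * Xx

/-- The ideal of size-two minors of the generic `2 × 3` matrix over `ℤ`. -/
noncomputable def I23 : Ideal (MvPolynomial (Fin 6) ℤ) := Ideal.span {Δ1, Δ2, Δ3}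

section
open CategoryTheory Limits Opposite

namespace H3
section Gen
variable {C D : Type*} [Category* C] [Category* D] [Abelian C] [Abelian D] [HasProjectiveResolutions C]

/-- The morphism out of homology determined by a cocycle. -/
noncomputable def gmor (K : ChainComplex D ℕ) (T : D) {n : ℕ} (φ : K.X n ⟶ T)
    (hφ : K.d (n+1) n ≫ φ = 0) : K.homology n ⟶ T :=
  K.homologyι n ≫ K.descOpcycles φ (n+1) (by simp) hφ

lemma gmor_surj (K : ChainComplex D ℕ) (T : D) [Injective T] {n : ℕ} (m : K.homology n ⟶ T) :
    ∃ (φ : K.X n ⟶ T) (hφ : K.d (n+1) n ≫ φ = 0), gmor K T φ hφ = m := by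
  let h' := Injective.factorThru m (K.homologyι n)
  have hh' : K.homologyι n ≫ h' = m := Injective.comp_factorThru _ _
  refine ⟨K.pOpcycles n ≫ h', by simp, ?_⟩
  rw [← hh', gmor]
  congr 1
  rw [← cancel_epi (K.pOpcycles n)]
  simp

lemma gmor_zsmul (K : ChainComplex D ℕ) (T : D) {n : ℕ} (φ : K.X n ⟶ T)
    (hφ : K.d (n+1) n ≫ φ = 0) (k : ℤ) (hφ') :
    gmor K T (k • φ) hφ' = k • gmor K T φ hφ := by
  rw [gmor, gmor, ← Preadditive.comp_zsmul]
  congr 1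
  rw [← cancel_epi (K.pOpcycles n)]
  simp

lemma gmor_add (K : ChainComplex D ℕ) (T : D) {n : ℕ} (φ ψ : K.X n ⟶ T)
    (hφ : K.d (n+1) n ≫ φ = 0) (hψ : K.d (n+1) n ≫ ψ = 0) (h') :
    gmor K T (φ + ψ) h' = gmor K T φ hφ + gmor K T ψ hψ := by
  rw [gmor, gmor, gmor, ← Preadditive.comp_add]
  congr 1
  rw [← cancel_epi (K.pOpcycles n)]
  simp

lemma gmor_zero_iff (K : ChainComplex D ℕ) (T : D) [Injective T] {n : ℕ} (φ : K.X (n+1) ⟶ T)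
    (hφ : K.d (n+1+1) (n+1) ≫ φ = 0) :
    gmor K T φ hφ = 0 ↔ ∃ ψ : K.X n ⟶ T, K.d (n+1) n ≫ ψ = φ := by
  constructor
  · intro h
    have ex : (ShortComplex.mk (K.homologyι (n+1)) (K.fromOpcycles (n+1) n)
      (by simp)).Exact := by
      apply ShortComplex.exact_of_f_is_kernel
      exact K.homologyIsKernel (n+1) n (by simp)
    have hg := ex.comp_descToInjective (K.descOpcycles φ (n+1+1) (by simp) hφ) h
    refine ⟨ex.descToInjective (K.descOpcycles φ (n+1+1) (by simp) hφ) h, ?_⟩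
    have := congrArg (fun k => K.pOpcycles (n+1) ≫ k) hg
    simpa using this
  · rintro ⟨g, rfl⟩
    have : K.descOpcycles (K.d (n+1) n ≫ g) (n+1+1) (by simp) hφ =
        K.fromOpcycles (n+1) n ≫ g := by
      rw [← cancel_epi (K.pOpcycles (n+1))]
      simp
    rw [gmor, this]
    simp

lemma gmor_map {K K' : ChainComplex D ℕ} (a : K' ⟶ K) (T : D) {n : ℕ} (φ : K.X n ⟶ T)
    (hφ : K.d (n+1) n ≫ φ = 0) (hφ') :
    HomologicalComplex.homologyMap a n ≫ gmor K T φ hφ = gmor K' T (a.f n ≫ φ) hφ' := by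
  rw [gmor, gmor, HomologicalComplex.homologyι_naturality_assoc]
  congr 1
  rw [← cancel_epi (K'.pOpcycles n)]
  simp

variable (F : C ⥤ D) [F.Additive]

noncomputable def lmor {X : C} (P : ProjectiveResolution X) (T : D) {n : ℕ}
    (φ : F.obj (P.complex.X n) ⟶ T) (hφ : F.map (P.complex.d (n+1) n) ≫ φ = 0) :
    (F.leftDerived n).obj X ⟶ T :=
  (P.isoLeftDerivedObj F n).hom ≫ gmor ((F.mapHomologicalComplex _).obj P.complex) T φ hφ

lemma lmor_surj {X : C} (P : ProjectiveResolution X) (T : D) [Injective T] {n : ℕ}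
    (m : (F.leftDerived n).obj X ⟶ T) :
    ∃ (φ : F.obj (P.complex.X n) ⟶ T) (hφ : F.map (P.complex.d (n+1) n) ≫ φ = 0),
      lmor F P T φ hφ = m := by
  obtain ⟨φ, hφ, h⟩ := gmor_surj ((F.mapHomologicalComplex _).obj P.complex) T 
    ((P.isoLeftDerivedObj F n).inv ≫ m)
  refine ⟨φ, hφ, ?_⟩
  unfold lmor
  exact (Iso.inv_comp_eq _).1 h.symm |>.symm

lemma lmor_zsmul {X : C} (P : ProjectiveResolution X) (T : D) {n : ℕ}
    (φ : F.obj (P.complex.X n) ⟶ T) (hφ : F.map (P.complex.d (n+1) n) ≫ φ = 0) (k : ℤ) (hφ') :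
    lmor F P T (k • φ) hφ' = k • lmor F P T φ hφ := by
  unfold lmor
  have := gmor_zsmul ((F.mapHomologicalComplex _).obj P.complex) T φ hφ k hφ'
  exact (congrArg _ this).trans (Preadditive.comp_zsmul _ _ _)

lemma lmor_add {X : C} (P : ProjectiveResolution X) (T : D) {n : ℕ}
    (φ ψ : F.obj (P.complex.X n) ⟶ T) (hφ : F.map (P.complex.d (n+1) n) ≫ φ = 0)
    (hψ : F.map (P.complex.d (n+1) n) ≫ ψ = 0) (h') :
    lmor F P T (φ + ψ) h' = lmor F P T φ hφ + lmor F P T ψ hψ := by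
  unfold lmor
  have := gmor_add ((F.mapHomologicalComplex _).obj P.complex) T φ ψ hφ hψ h'
  exact (congrArg _ this).trans (Preadditive.comp_add _ _ _ _ _ _)

lemma lmor_zero_iff {X : C} (P : ProjectiveResolution X) (T : D) [Injective T] {n : ℕ}
    (φ : F.obj (P.complex.X (n+1)) ⟶ T)
    (hφ : F.map (P.complex.d (n+1+1) (n+1)) ≫ φ = 0) :
    lmor F P T φ hφ = 0 ↔ ∃ ψ : F.obj (P.complex.X n) ⟶ T, F.map (P.complex.d (n+1) n) ≫ ψ = φ := by
  refine Iff.trans ?_ (gmor_zero_iff ((F.mapHomologicalComplex _).obj P.complex) T φ hφ)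
  unfold lmor
  exact ⟨fun h => (cancel_epi (P.isoLeftDerivedObj F (n+1)).hom).1 (h.trans comp_zero.symm),
    fun h => (congrArg _ h).trans comp_zero⟩

lemma lmor_map {X X' : C} (P : ProjectiveResolution X) (P' : ProjectiveResolution X') (a : X' ⟶ X)
    (Φ : ProjectiveResolution.Hom P' P a) (T : D) {n : ℕ}
    (φ : F.obj (P.complex.X n) ⟶ T) (hφ : F.map (P.complex.d (n+1) n) ≫ φ = 0) (hφ') :
    (F.leftDerived n).map a ≫ lmor F P T φ hφ = lmor F P' T (F.map (Φ.hom.f n) ≫ φ) hφ' := by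
  have h0 := ProjectiveResolution.isoLeftDerivedObj_hom_naturality a P' P Φ.hom
    (Φ.hom_f_zero_comp_π_f_zero.trans
      (congrArg (fun k => P'.π.f 0 ≫ k) (ChainComplex.single₀_map_f_zero a))) F n
  have h1 := gmor_map ((F.mapHomologicalComplex _).map Φ.hom) T φ hφ hφ'
  unfold lmor
  refine (Category.assoc _ _ _).symm.trans ?_
  refine (congrArg (fun k => k ≫ gmor ((F.mapHomologicalComplex _).obj P.complex) T φ hφ) h0).trans ?_
  refine (Category.assoc _ _ _).trans ?_
  exact congrArg _ h1
end Gen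
end H3

end

section
open CategoryTheory Limits Opposite

namespace H3
section OldExt
universe u
variable {R : Type u} [CommRing R]

abbrev YF (Y : ModuleCat.{u} R) : ModuleCat.{u} R ⥤ (ModuleCat.{u} R)ᵒᵖ :=
  ((linearYoneda R (ModuleCat.{u} R)).obj Y).rightOp

/-- The map `R → M` sending `1` to `f`, in the opposite category. -/
noncomputable def phi (M : ModuleCat.{u} R) (f : M) : op M ⟶ op (ModuleCat.of R R) :=
  (ModuleCat.ofHom (LinearMap.toSpanSingleton R M f)).op

lemma phi_surj (M : ModuleCat.{u} R) (g : op M ⟶ op (ModuleCat.of R R)) :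
    ∃ f, phi M f = g := by
  refine ⟨g.unop.hom (1 : R), ?_⟩
  apply Quiver.Hom.unop_inj
  apply ModuleCat.hom_ext
  apply LinearMap.ext_ring
  exact one_smul R _

lemma phi_one (M : ModuleCat.{u} R) (f : M) : (phi M f).unop.hom (1 : R) = f :=
  one_smul R f

lemma phi_inj (M : ModuleCat.{u} R) {f g : M} (h : phi M f = phi M g) : f = g := by
  rw [← phi_one M f, ← phi_one M g, h]

lemma phi_comp {M N : ModuleCat.{u} R} (a : M ⟶ N) (f : M) :
    a.op ≫ phi M f = phi N (a.hom f) := by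
  apply Quiver.Hom.unop_inj
  apply ModuleCat.hom_ext
  apply LinearMap.ext_ring
  change a.hom ((1 : R) • f) = (1 : R) • a.hom f
  simp

lemma phi_zero (M : ModuleCat.{u} R) : phi M (0 : M) = 0 := by
  apply Quiver.Hom.unop_inj
  apply ModuleCat.hom_ext
  apply LinearMap.ext_ring
  exact smul_zero _

lemma phi_smul (M : ModuleCat.{u} R) (n : ℤ) (f : M) : phi M (n • f) = n • phi M f := by
  apply Quiver.Hom.unop_inj
  apply ModuleCat.hom_ext
  apply LinearMap.ext_ring
  change (1 : R) • n • f = n • (1 : R) • f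
  simp

lemma phi_add (M : ModuleCat.{u} R) (f g : M) : phi M (f + g) = phi M f + phi M g := by
  apply Quiver.Hom.unop_inj
  apply ModuleCat.hom_ext
  apply LinearMap.ext_ring
  exact smul_add _ _ _

/-- The morphism in the opposite category attached to `f : A ⟶ Y`. -/
noncomputable def phiY {A Y : ModuleCat.{u} R} (f : A ⟶ Y) :
    (YF Y).obj A ⟶ op (ModuleCat.of R R) := phi (ModuleCat.of R (A ⟶ Y)) f

lemma phiY_comp {A A' Y : ModuleCat.{u} R} (a : A' ⟶ A) (f : A ⟶ Y) :
    (YF Y).map a ≫ phiY f = phiY (a ≫ f) :=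
  phi_comp (((linearYoneda R (ModuleCat.{u} R)).obj Y).map a.op) f

lemma phiY_surj {A Y : ModuleCat.{u} R} (g : (YF Y).obj A ⟶ op (ModuleCat.of R R)) :
    ∃ f : A ⟶ Y, phiY f = g := phi_surj (ModuleCat.of R (A ⟶ Y)) g

lemma phiY_inj {A Y : ModuleCat.{u} R} {f g : A ⟶ Y} (h : phiY f = phiY g) : f = g :=
  phi_inj (ModuleCat.of R (A ⟶ Y)) h

lemma phiY_zero {A Y : ModuleCat.{u} R} : phiY (0 : A ⟶ Y) = 0 :=
  phi_zero (ModuleCat.of R (A ⟶ Y))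

lemma phiY_smul {A Y : ModuleCat.{u} R} (n : ℤ) (f : A ⟶ Y) : phiY (n • f) = n • phiY f :=
  phi_smul (ModuleCat.of R (A ⟶ Y)) n f

lemma phiY_add {A Y : ModuleCat.{u} R} (f g : A ⟶ Y) : phiY (f + g) = phiY f + phiY g :=
  phi_add (ModuleCat.of R (A ⟶ Y)) f g

lemma injR : Injective (op (ModuleCat.of R R)) := by
  have : Projective (ModuleCat.of R R) := 
    (IsProjective.iff_projective (R := R) R).1 inferInstance
  infer_instance

lemma cocyc {X Y : ModuleCat.{u} R} (P : ProjectiveResolution X) {n : ℕ}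
    {f : P.complex.X n ⟶ Y} (hf : P.complex.d (n+1) n ≫ f = 0) :
    (YF Y).map (P.complex.d (n+1) n) ≫ phiY f = 0 := by
  rw [phiY_comp, hf, phiY_zero]

/-- The `Ext` module of the classical definition. -/
noncomputable abbrev OE (n : ℕ) (X Y : ModuleCat.{u} R) : ModuleCat.{u} R :=
  ((Ext R (ModuleCat.{u} R) n).obj (op X)).obj Y

/-- The class of a cocycle as a morphism in the opposite category. -/
noncomputable def lm {X Y : ModuleCat.{u} R} (P : ProjectiveResolution X) {n : ℕ}
    (f : P.complex.X n ⟶ Y) (hf : P.complex.d (n+1) n ≫ f = 0) :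
    op (OE n X Y) ⟶ op (ModuleCat.of R R) :=
  lmor (YF Y) P (op (ModuleCat.of R R)) (phiY f) (cocyc P hf)

/-- The class of a cocycle. -/
noncomputable def oldMk {X Y : ModuleCat.{u} R} (P : ProjectiveResolution X) {n : ℕ}
    (f : P.complex.X n ⟶ Y) (hf : P.complex.d (n+1) n ≫ f = 0) : OE n X Y :=
  (lm P f hf).unop.hom (1 : R)

lemma phi_oldMk {X Y : ModuleCat.{u} R} (P : ProjectiveResolution X) {n : ℕ}
    (f : P.complex.X n ⟶ Y) (hf : P.complex.d (n+1) n ≫ f = 0) :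
    phi (OE n X Y) (oldMk P f hf) = lm P f hf := by
  apply Quiver.Hom.unop_inj
  apply ModuleCat.hom_ext
  apply LinearMap.ext_ring
  exact one_smul R _

lemma oldMk_surj {X Y : ModuleCat.{u} R} (P : ProjectiveResolution X) {n : ℕ}
    (x : OE n X Y) : ∃ f hf, oldMk P (n := n) f hf = x := by
  have := injR (R := R)
  obtain ⟨φ, hφ, h⟩ := lmor_surj (YF Y) P (op (ModuleCat.of R R)) (phi (OE n X Y) x)
  obtain ⟨f, rfl⟩ := phiY_surj φ
  have hf : P.complex.d (n+1) n ≫ f = 0 := by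
    apply phiY_inj
    rw [phiY_zero, ← phiY_comp]
    exact hφ
  refine ⟨f, hf, phi_inj _ ?_⟩
  rw [← h, phi_oldMk, lm]

lemma oldMk_smul {X Y : ModuleCat.{u} R} (P : ProjectiveResolution X) {n : ℕ} (k : ℤ)
    (f : P.complex.X n ⟶ Y) (hf : P.complex.d (n+1) n ≫ f = 0) (hf') :
    oldMk P (k • f) hf' = k • oldMk P f hf := by
  apply phi_inj
  have h2 : (YF Y).map (P.complex.d (n+1) n) ≫ (k • phiY f) = 0 := by
    rw [Preadditive.comp_zsmul, cocyc P hf, smul_zero]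
  have h := lmor_zsmul (YF Y) P (op (ModuleCat.of R R)) (phiY f) (cocyc P hf) k h2
  rw [phi_oldMk, phi_smul, phi_oldMk]
  refine Eq.trans ?_ h
  unfold lm
  congr 1
  exact phiY_smul k f

lemma oldMk_add {X Y : ModuleCat.{u} R} (P : ProjectiveResolution X) {n : ℕ}
    (f g : P.complex.X n ⟶ Y) (hf : P.complex.d (n+1) n ≫ f = 0)
    (hg : P.complex.d (n+1) n ≫ g = 0) (hf') :
    oldMk P (f + g) hf' = oldMk P f hf + oldMk P g hg := by
  apply phi_inj
  have h2 : (YF Y).map (P.complex.d (n+1) n) ≫ (phiY f + phiY g) = 0 := by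
    rw [Preadditive.comp_add, cocyc P hf, cocyc P hg, add_zero]
  have h := lmor_add (YF Y) P (op (ModuleCat.of R R)) (phiY f) (phiY g) (cocyc P hf) (cocyc P hg) h2
  rw [phi_oldMk, phi_add, phi_oldMk, phi_oldMk]
  refine Eq.trans ?_ h
  unfold lm
  congr 1
  exact phiY_add f g

lemma oldMk_eq_zero {X Y : ModuleCat.{u} R} (P : ProjectiveResolution X) {n : ℕ}
    (f : P.complex.X (n+1) ⟶ Y) (hf : P.complex.d (n+1+1) (n+1) ≫ f = 0) :
    oldMk P f hf = 0 ↔ ∃ g : P.complex.X n ⟶ Y, P.complex.d (n+1) n ≫ g = f := by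
  have := injR (R := R)
  have h1 : oldMk P f hf = 0 ↔ lm P f hf = 0 := by
    rw [← phi_oldMk]
    exact ⟨fun h => by rw [h]; exact phi_zero _, fun h => phi_inj _ (h.trans (phi_zero _).symm)⟩
  refine h1.trans ((lmor_zero_iff (YF Y) P (op (ModuleCat.of R R)) (phiY f) (cocyc P hf)).trans ?_)
  constructor
  · rintro ⟨ψ, hψ⟩
    obtain ⟨g, rfl⟩ := phiY_surj ψ
    refine ⟨g, phiY_inj ?_⟩
    exact (phiY_comp _ _).symm.trans hψ
  · rintro ⟨g, rfl⟩
    exact ⟨phiY g, phiY_comp _ _⟩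

lemma oldMk_map {X X' Y : ModuleCat.{u} R} (P : ProjectiveResolution X)
    (P' : ProjectiveResolution X') (a : X' ⟶ X) (φ : ProjectiveResolution.Hom P' P a) {n : ℕ}
    (f : P.complex.X n ⟶ Y) (hf : P.complex.d (n+1) n ≫ f = 0) (hf') :
    (((Ext R (ModuleCat.{u} R) n).map a.op).app Y).hom (oldMk P f hf) =
      oldMk P' (φ.hom.f n ≫ f) hf' := by
  apply phi_inj
  rw [phi_oldMk, ← phi_comp, phi_oldMk]
  have e := phiY_comp (φ.hom.f n) f
  have h := lmor_map (YF Y) P P' a φ (op (ModuleCat.of R R)) (phiY f) (cocyc P hf)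
    (by rw [e]; exact cocyc P' hf')
  refine Eq.trans ?_ (h.trans ?_)
  · rfl
  · unfold lm
    congr 1
end OldExt
end H3

end

section
open CategoryTheory Limits Opposite

namespace H3
section Transfer
variable {R : Type} [CommRing R]

lemma exists_hom {X X' : ModuleCat.{0} R} (P : ProjectiveResolution X)
    (P' : ProjectiveResolution X') (a : X' ⟶ X) : Nonempty (ProjectiveResolution.Hom P' P a) := by
  refine ⟨⟨ProjectiveResolution.lift a P' P, ?_⟩⟩
  have h := ProjectiveResolution.lift_commutes a P' P
  exact congrArg (fun k => k.f 0) h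

lemma extMk_zsmul {X Y : ModuleCat.{0} R} (P : ProjectiveResolution X) {n : ℕ} (k : ℤ)
    (f : P.complex.X n ⟶ Y) (hf : P.complex.d (n+1) n ≫ f = 0) (hf') :
    P.extMk (k • f) (n+1) rfl hf' = k • P.extMk f (n+1) rfl hf := by
  let A : AddSubgroup (P.complex.X n ⟶ Y) :=
    { carrier := {f | P.complex.d (n+1) n ≫ f = 0}
      add_mem' := fun {a b} ha hb => by
        change _ ≫ _ = 0
        change _ ≫ _ = 0 at ha
        change _ ≫ _ = 0 at hb
        rw [Preadditive.comp_add, ha, hb, add_zero]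
      zero_mem' := comp_zero
      neg_mem' := fun {a} ha => by
        change _ ≫ _ = 0
        change _ ≫ _ = 0 at ha
        rw [Preadditive.comp_neg, ha, neg_zero] }
  let T : A →+ Abelian.Ext X Y n := AddMonoidHom.mk' (fun f => P.extMk f.1 (n+1) rfl f.2)
    (fun a b => (P.add_extMk _ _ _ _ a.2 b.2).symm)
  exact map_zsmul T k (⟨f, hf⟩ : A)

variable (k : ℤ) {X X' Y : ModuleCat.{0} R} (a : X' ⟶ X) {n : ℕ}


/-- Correspondence between old and new Ext -/
def Corr {n : ℕ} (x : OE n X Y) (y : Abelian.Ext X Y n) : Prop :=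
  ∃ (P : ProjectiveResolution X) (f : _) (hf : P.complex.d (n+1) n ≫ f = 0),
    oldMk P f hf = x ∧ P.extMk f (n+1) rfl hf = y

lemma Corr.exists_new (x : OE n X Y) : ∃ y, Corr x y := by
  let P := ProjectiveResolution.of X
  obtain ⟨f, hf, h⟩ := oldMk_surj P x
  exact ⟨_, P, f, hf, h, rfl⟩

lemma Corr.exists_old (y : Abelian.Ext X Y n) : ∃ x, Corr x y := by
  let P := ProjectiveResolution.of X
  obtain ⟨f, hf, h⟩ := P.extMk_surjective y (n+1) rfl
  exact ⟨_, P, f, hf, rfl, h⟩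

lemma Corr.zsmul {x : OE n X Y} {y} (h : Corr x y) : Corr (k • x) (k • y) := by
  obtain ⟨P, f, hf, rfl, rfl⟩ := h
  have : P.complex.d (n+1) n ≫ (k • f) = 0 := by rw [Preadditive.comp_zsmul, hf, smul_zero]
  exact ⟨P, k • f, this, oldMk_smul P k f hf this, extMk_zsmul P k f hf this⟩

lemma Corr.map {x : OE n X Y} {y} (h : Corr x y) :
    Corr ((((Ext R (ModuleCat.{0} R) n).map a.op).app Y).hom x)
      ((Abelian.Ext.mk₀ a).comp y (zero_add _)) := by
  obtain ⟨P, f, hf, rfl, rfl⟩ := h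
  let P' := ProjectiveResolution.of X'
  obtain ⟨φ⟩ := exists_hom P P' a
  have : P'.complex.d (n+1) n ≫ φ.hom.f n ≫ f = 0 := by
    rw [← HomologicalComplex.Hom.comm_assoc, hf, comp_zero]
  exact ⟨P', _, this, (oldMk_map P P' a φ f hf this).symm,
    (ProjectiveResolution.mk₀_comp_extMk f (n+1) rfl hf φ).symm⟩

lemma id_hom_f {P P' : ProjectiveResolution X} (φ : ProjectiveResolution.Hom P' P (𝟙 X))
    (f : P.complex.X n ⟶ Y) (hf : P.complex.d (n+1) n ≫ f = 0) (hf') :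
    oldMk P' (φ.hom.f n ≫ f) hf' = oldMk P f hf := by
  rw [← oldMk_map P P' (𝟙 X) φ f hf hf']
  rw [op_id, CategoryTheory.Functor.map_id]
  rfl

lemma Corr.eq_zero_iff {x : OE (n+1) X Y} {y} (h : Corr x y) : x = 0 ↔ y = 0 := by
  obtain ⟨P, f, hf, rfl, rfl⟩ := h
  rw [oldMk_eq_zero, P.extMk_eq_zero_iff f _ _ hf n rfl]

lemma Corr.sub {x x' : OE n X Y} {y y'} (h : Corr x y) (h' : Corr x' y') :
    Corr (x - x') (y - y') := by
  obtain ⟨P, f, hf, rfl, rfl⟩ := h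
  obtain ⟨P', f', hf', rfl, rfl⟩ := h'
  obtain ⟨φ⟩ := exists_hom P P' (𝟙 X)
  have h1 : P'.complex.d (n+1) n ≫ φ.hom.f n ≫ f = 0 := by
    rw [← HomologicalComplex.Hom.comm_assoc, hf, comp_zero]
  have h2 : P'.complex.d (n+1) n ≫ ((-1 : ℤ) • f') = 0 := by
    rw [Preadditive.comp_zsmul, hf', smul_zero]
  have h3 : P'.complex.d (n+1) n ≫ (φ.hom.f n ≫ f + (-1 : ℤ) • f') = 0 := by
    rw [Preadditive.comp_add, h1, h2, add_zero]
  refine ⟨P', _, h3, ?_, ?_⟩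
  · rw [oldMk_add P' _ _ h1 h2, id_hom_f, oldMk_smul P' (-1) f' hf' h2, neg_one_zsmul,
      sub_eq_add_neg]
  · rw [← P'.add_extMk _ _ _ _ h1 h2, extMk_zsmul P' (-1) f' hf' h2, neg_one_zsmul,
      sub_eq_add_neg, ← ProjectiveResolution.mk₀_comp_extMk f (n+1) rfl hf φ]
    rw [Abelian.Ext.mk₀_id_comp]

/-- the transition map `R/J^{t'} → R/J^t`. -/
abbrev prj (J : Ideal R) {t t' : ℕ} (h : t ≤ t') :
    ModuleCat.of R (R ⧸ J ^ t') ⟶ ModuleCat.of R (R ⧸ J ^ t) :=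
  ModuleCat.ofHom (Submodule.mapQ _ _ LinearMap.id (Ideal.pow_le_pow_right h))

theorem bij_of_ext (J : Ideal R) (M : ModuleCat.{0} R) (k : ℤ) (n : ℕ)
    (hinj : ∀ (t : ℕ) (x : Abelian.Ext (ModuleCat.of R (R ⧸ J ^ t)) M (n+1)), k • x = 0 →
      ∃ (t' : ℕ) (h : t ≤ t'), (Abelian.Ext.mk₀ (prj J h)).comp x (zero_add _) = 0)
    (hsurj : ∀ (t : ℕ) (x : Abelian.Ext (ModuleCat.of R (R ⧸ J ^ t)) M (n+1)),
      ∃ (t' : ℕ) (h : t ≤ t') (y : _), (Abelian.Ext.mk₀ (prj J h)).comp x (zero_add _) = k • y) :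
    Function.Bijective (fun m : (localCohomology J (n+1)).obj M => k • m) := by
  let F := localCohomology.diagram (localCohomology.idealPowersDiagram J) (n+1)
  have hc : IsColimit (((evaluation _ _).obj M).mapCocone (colimit.cocone F)) :=
    isColimitOfPreserves _ (colimit.isColimit F)
  let D := ((evaluation _ _).obj M).mapCocone (colimit.cocone F)
  have hD : D.pt = (localCohomology J (n+1)).obj M := rfl
  change Function.Bijective (fun m : D.pt => k • m)
  have hmap : ∀ {t t' : ℕ} (h : t ≤ t') (x : OE (n+1) (ModuleCat.of R (R ⧸ J ^ t)) M),
      (D.ι.app (op (op t'))).hom ((((Ext R (ModuleCat.{0} R) (n+1)).map (prj J h).op).app M).hom x)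
       = (D.ι.app (op (op t))).hom x := by
    intro t t' h x
    have := D.w (homOfLE h).op.op
    rw [← this]
    rfl
  constructor
  · intro m1 m2 hm
    rw [← sub_eq_zero] at hm ⊢
    simp only at hm
    rw [← smul_sub] at hm
    generalize m1 - m2 = m at hm
    obtain ⟨j, x, rfl⟩ := Concrete.isColimit_exists_rep _ hc m
    have h0 : (D.ι.app j).hom (k • x) = (D.ι.app j).hom 0 := by
      rw [map_zero, map_zsmul]; exact hm
    obtain ⟨j', f, g, hfg⟩ := Concrete.isColimit_exists_of_rep_eq.{0} _ hc (k • x) 0 h0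
    let t := j.unop.unop
    let t' := j'.unop.unop
    have htt : t ≤ t' := f.unop.unop.down.down
    let x' : OE (n+1) (ModuleCat.of R (R ⧸ J ^ t')) M :=
      (((Ext R (ModuleCat.{0} R) (n+1)).map (prj J htt).op).app M).hom x
    have hx' : k • x' = 0 := by
      refine Eq.trans (map_zsmul ((F ⋙ (evaluation _ _).obj M).map f).hom k x).symm ?_
      refine Eq.trans hfg ?_
      exact map_zero ((F ⋙ (evaluation _ _).obj M).map g).hom
    obtain ⟨y, hy⟩ := Corr.exists_new x'
    have hky : k • y = 0 := ((hy.zsmul k).eq_zero_iff).1 hx'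
    obtain ⟨t'', h, h3⟩ := hinj t' y hky
    have h4 := ((hy.map (prj J h)).eq_zero_iff).2 h3
    have h5 := hmap h x'
    rw [h4] at h5
    exact ((hmap htt x).symm.trans (h5.symm.trans (map_zero (D.ι.app (op (op t''))).hom)))
  · intro m
    obtain ⟨j, x, rfl⟩ := Concrete.isColimit_exists_rep _ hc m
    let t := j.unop.unop
    obtain ⟨y, hy⟩ := Corr.exists_new (n := n+1) (X := ModuleCat.of R (R ⧸ J ^ t)) (Y := M) x
    obtain ⟨t', h, z, hz⟩ := hsurj t y
    obtain ⟨z', hz'⟩ := Corr.exists_old z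
    have h1 := ((hy.map (prj J h)).sub (hz'.zsmul k)).eq_zero_iff.2 (sub_eq_zero.2 hz)
    refine ⟨(D.ι.app (op (op t'))).hom z', ?_⟩
    have h2 := hmap h x
    rw [sub_eq_zero.1 h1] at h2
    exact (map_zsmul (D.ι.app (op (op t'))).hom k z').symm.trans h2
end Transfer
end H3

end

section
open CategoryTheory Limits Opposite

namespace H3
section ExtArg
variable {R : Type} [CommRing R]

lemma ses {A B C : Type} [AddCommGroup A] [AddCommGroup B] [AddCommGroup C] [Module R A]
    [Module R B] [Module R C] (f : A →ₗ[R] B) (g : B →ₗ[R] C) (hf : Function.Injective f)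
    (hg : Function.Surjective g) (h : Function.Exact f g) (w) :
    (ShortComplex.mk (ModuleCat.ofHom f) (ModuleCat.ofHom g) w).ShortExact :=
  ModuleCat.shortComplex_shortExact _ h hf hg

lemma ses_w {A B C : Type} [AddCommGroup A] [AddCommGroup B] [AddCommGroup C] [Module R A]
    [Module R B] [Module R C] {f : A →ₗ[R] B} {g : B →ₗ[R] C} (h : Function.Exact f g) :
    ModuleCat.ofHom f ≫ ModuleCat.ofHom g = 0 := by
  rw [← ModuleCat.ofHom_comp, h.linearMap_comp_eq_zero]; rfl

/-- `Ext` vanishes when `f` acts invertibly on the target and nilpotently on the source. -/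
lemma ext_vanish {X L : ModuleCat.{0} R} (f : R) (s : ℕ) (hX : ∀ x : X, f ^ s • x = 0)
    (hL : Function.Bijective (fun l : L => f • l)) {i : ℕ} (x : Abelian.Ext X L i) : x = 0 := by
  let e : L →ₗ[R] L := LinearMap.lsmul R L f
  let e' : L ≃ₗ[R] L := LinearEquiv.ofBijective e hL
  have h1 : f ^ s • x = 0 := by
    have h2 : (f ^ s) • (𝟙 X : X ⟶ X) = 0 := by
      ext y
      exact hX y
    have h3 := Abelian.Ext.smul_comp (Abelian.Ext.mk₀ (𝟙 X)) x (zero_add i) (f ^ s)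
    rw [← Abelian.Ext.mk₀_smul, h2, Abelian.Ext.mk₀_zero, Abelian.Ext.zero_comp,
      Abelian.Ext.mk₀_id_comp] at h3
    exact h3.symm
  have h2 : ∀ z : Abelian.Ext X L i, f • z = 0 → z = 0 := by
    intro z hz
    rw [Abelian.Ext.smul_eq_comp_mk₀] at hz
    have h4 : (f • 𝟙 L) ≫ ModuleCat.ofHom e'.symm.toLinearMap = 𝟙 L := by
      ext y
      exact e'.symm_apply_apply y
    have h5 := congrArg (fun k => Abelian.Ext.comp k
      (Abelian.Ext.mk₀ (ModuleCat.ofHom e'.symm.toLinearMap)) (add_zero i)) hz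
    simp only [Abelian.Ext.comp_assoc_of_third_deg_zero, Abelian.Ext.mk₀_comp_mk₀,
      Abelian.Ext.zero_comp] at h5
    change z.comp (Abelian.Ext.mk₀ ((f • 𝟙 L) ≫ ModuleCat.ofHom e'.symm.toLinearMap)) _ = 0 at h5
    rwa [h4, Abelian.Ext.comp_mk₀_id] at h5
  clear hX
  induction s with
  | zero => simpa using h1
  | succ s ih =>
    apply ih
    apply h2
    rw [smul_smul, ← pow_succ', h1]

lemma dimShift {X : ModuleCat.{0} R} {S : ShortComplex (ModuleCat.{0} R)} (hS : S.ShortExact)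
    (hv : ∀ (i : ℕ) (x : Abelian.Ext X S.X₂ i), x = 0) (r : R) {i : ℕ}
    (x : Abelian.Ext X S.X₁ (i+1)) (hx : r • x = 0) :
    ∃ y : Abelian.Ext X S.X₃ i, y.comp hS.extClass rfl = x ∧ r • y = 0 := by
  obtain ⟨y, hy⟩ := Abelian.Ext.covariant_sequence_exact₁ _ hS x (hv _ _) rfl
  refine ⟨y, hy, ?_⟩
  obtain ⟨z, hz⟩ := Abelian.Ext.covariant_sequence_exact₃ _ hS (r • y) rfl
    (by rw [Abelian.Ext.smul_comp, hy, hx])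
  rw [← hz, hv _ z, Abelian.Ext.zero_comp]

/-- The short exact sequence `J → R → R/J`. -/
noncomputable abbrev scQ (J : Ideal R) : ShortComplex (ModuleCat.{0} R) :=
  ShortComplex.mk (ModuleCat.ofHom (Submodule.subtype J)) (ModuleCat.ofHom (Submodule.mkQ J))
    (ses_w (LinearMap.exact_subtype_mkQ J))

lemma scQ_exact (J : Ideal R) : (scQ J).ShortExact :=
  ses _ _ (Submodule.subtype_injective J) (Submodule.mkQ_surjective J)
    (LinearMap.exact_subtype_mkQ J) _

lemma vanish_mul {K : Type} [AddCommGroup K] [Module R K] (A J : Ideal R) (φ : J →ₗ[R] K)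
    (hs : ∀ m : J, ∀ a ∈ A, a • φ m = 0) (b : R) (hb : b ∈ A * J) (hb' : b ∈ J) :
    φ ⟨b, hb'⟩ = 0 := by
  have h : A * J ≤ Submodule.map J.subtype (LinearMap.ker φ) := by
    rw [Ideal.mul_le]
    intro r hr n hn
    refine ⟨r • ⟨n, hn⟩, ?_, rfl⟩
    exact (map_smul φ r _).trans (hs _ r hr)
  obtain ⟨c, hc, rfl⟩ := h hb
  exact hc

/-- Lemma C -/
lemma torsion_ext_one [IsNoetherianRing R] (I : Ideal R) (K : ModuleCat.{0} R)
    (hK : ∀ m : K, ∃ s : ℕ, ∀ a ∈ I ^ s, a • m = 0) (t : ℕ)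
    (k : Abelian.Ext (ModuleCat.of R (R ⧸ I ^ t)) K 1) :
    ∃ (t' : ℕ) (h : t ≤ t'), (Abelian.Ext.mk₀ (prj I h)).comp k (zero_add _) = 0 := by
  have : Projective (ModuleCat.of R R) := 
    (IsProjective.iff_projective (R := R) R).1 inferInstance
  obtain ⟨φ, hφ⟩ := Abelian.Ext.contravariant_sequence_exact₃ (scQ_exact (I ^ t)) K k
    (Abelian.Ext.eq_zero_of_projective (P := ModuleCat.of R R) _) (add_zero 1)
  obtain ⟨φ', rfl⟩ := (Abelian.Ext.mk₀_bijective _ _).2 φ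
  have hfg : (LinearMap.range φ'.hom).FG := by
    have : IsNoetherian R ((scQ (I ^ t)).X₁) := inferInstanceAs (IsNoetherian R (I ^ t : Ideal R))
    exact Module.Finite.fg_top.map φ'.hom |> fun h => by rwa [← LinearMap.range_eq_map] at h
  have hs : ∃ s : ℕ, ∀ m ∈ LinearMap.range φ'.hom, ∀ a ∈ I ^ s, a • m = 0 := by
    obtain ⟨G, hG⟩ := hfg
    choose s hs using hK
    refine ⟨G.sup s, fun m hm => ?_⟩
    rw [← hG] at hm
    induction hm using Submodule.span_induction with
    | mem x hx => exact fun a ha => hs x a (Ideal.pow_le_pow_right (Finset.le_sup hx) ha)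
    | zero => intro a _; exact smul_zero a
    | add x y _ _ hx hy => intro a ha; rw [smul_add, hx a ha, hy a ha, add_zero]
    | smul b x _ hx => intro a ha; rw [smul_comm, hx a ha, smul_zero]
  obtain ⟨s, hs⟩ := hs
  refine ⟨t + s, Nat.le_add_right t s, ?_⟩
  have hle : I ^ (t + s) ≤ I ^ t := Ideal.pow_le_pow_right (Nat.le_add_right t s)
  let F : scQ (I ^ (t + s)) ⟶ scQ (I ^ t) :=
    { τ₁ := ModuleCat.ofHom (Submodule.inclusion hle)
      τ₂ := 𝟙 _
      τ₃ := prj I (Nat.le_add_right t s)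
      comm₁₂ := by ext; rfl
      comm₂₃ := by ext; rfl }
  have hnat := (scQ_exact (I ^ (t + s))).extClass_naturality (scQ_exact (I ^ t)) F
  have h0 : F.τ₁ ≫ φ' = 0 := by
    ext ⟨a, ha⟩
    change φ'.hom (⟨a, hle ha⟩ : (I ^ t : Ideal R)) = 0
    have ha' := ha
    rw [add_comm, pow_add] at ha'
    exact vanish_mul (I ^ s) (I ^ t) φ'.hom (fun m a ha => hs _ ⟨m, rfl⟩ a ha) a ha' _
  rw [← hφ]
  change (Abelian.Ext.mk₀ F.τ₃).comp _ _ = 0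
  rw [← Abelian.Ext.comp_assoc _ _ _ (zero_add 1) (add_zero 1) (by norm_num), ← hnat,
    Abelian.Ext.comp_assoc _ _ _ (add_zero 1) (add_zero 0) (by norm_num),
    Abelian.Ext.mk₀_comp_mk₀, h0, Abelian.Ext.mk₀_zero, Abelian.Ext.comp_zero]

end ExtArg
end H3

end

section
open CategoryTheory Limits Opposite

namespace H3
section Uni
variable {R : Type} [CommRing R]

/-- Localization at one element. -/
abbrev Lf (f : R) (N : Type) [AddCommGroup N] [Module R N] : Type :=
  LocalizedModule (Submonoid.powers f) N

/-- The map `N → N_f`. -/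
noncomputable abbrev mkf (f : R) (N : Type) [AddCommGroup N] [Module R N] : N →ₗ[R] Lf f N :=
  LocalizedModule.mkLinearMap (Submonoid.powers f) N

/-- The cokernel of `N → N_f`. -/
abbrev TL (f : R) (N : Type) [AddCommGroup N] [Module R N] : Type :=
  Lf f N ⧸ LinearMap.range (mkf f N)

variable {M N : Type} [AddCommGroup N] [Module R N] [AddCommGroup M] [Module R M]

lemma Lf_bij (f : R) : Function.Bijective (fun l : Lf f N => f • l) := by
  have := IsLocalizedModule.map_units (mkf f N) ⟨f, Submonoid.mem_powers f⟩
  exact (Module.End.isUnit_iff _).1 this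

lemma mkf_inj (f : R) (h : ∀ n : N, f • n = 0 → n = 0) : Function.Injective (mkf f N) := by
  have h' : ∀ (s : ℕ) (n : N), f ^ s • n = 0 → n = 0 := by
    intro s
    induction s with
    | zero => intro n hn; simpa using hn
    | succ s ih => intro n hn; apply h; apply ih; rwa [smul_smul, ← pow_succ]
  rw [injective_iff_map_eq_zero]
  intro n hn
  have := (IsLocalizedModule.eq_zero_iff (Submonoid.powers f) (mkf f N)).1 hn
  obtain ⟨⟨_, s, rfl⟩, hs⟩ := this
  exact h' s n hs

lemma mkf_ker {f : R} {n : N} (hn : mkf f N n = 0) : ∃ s : ℕ, f ^ s • n = 0 := by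
  have := (IsLocalizedModule.eq_zero_iff (Submonoid.powers f) (mkf f N)).1 hn
  obtain ⟨⟨_, s, rfl⟩, hs⟩ := this
  exact ⟨s, hs⟩

/-- `n / f^t` in `N_f`. -/
noncomputable abbrev fr (f : R) (t : ℕ) (n : N) : Lf f N :=
  LocalizedModule.mk n (⟨f ^ t, t, rfl⟩ : Submonoid.powers f)

lemma fr_surj (f : R) (x : Lf f N) : ∃ t n, x = fr f t n := by
  induction x using LocalizedModule.induction_on with
  | _ n s =>
    obtain ⟨_, t, rfl⟩ := s
    exact ⟨t, n, rfl⟩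

lemma pow_smul_fr (f : R) (t : ℕ) (n : N) : f ^ t • fr f t n = mkf f N n := by
  exact LocalizedModule.mk_cancel (⟨f ^ t, t, rfl⟩ : Submonoid.powers f) n |> fun h => by
    rw [LocalizedModule.mkLinearMap_apply, ← h, LocalizedModule.smul'_mk]
    rfl

lemma TL_tors (f : R) (x : TL f N) : ∃ s : ℕ, f ^ s • x = 0 := by
  obtain ⟨x, rfl⟩ := Submodule.Quotient.mk_surjective _ x
  obtain ⟨t, n, rfl⟩ := fr_surj f x
  refine ⟨t, ?_⟩
  rw [← Submodule.Quotient.mk_smul, Submodule.Quotient.mk_eq_zero, pow_smul_fr]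
  exact ⟨n, rfl⟩

lemma TL_tors' (f g : R) (h : ∀ n : N, ∃ s : ℕ, g ^ s • n = 0) (x : TL f N) :
    ∃ s : ℕ, g ^ s • x = 0 := by
  obtain ⟨x, rfl⟩ := Submodule.Quotient.mk_surjective _ x
  obtain ⟨t, n, rfl⟩ := fr_surj f x
  obtain ⟨s, hs⟩ := h n
  refine ⟨s, ?_⟩
  rw [← Submodule.Quotient.mk_smul, LocalizedModule.smul'_mk, hs, LocalizedModule.zero_mk,
    Submodule.Quotient.mk_zero]

lemma kill_quot (I : Ideal R) (f : R) (hf : f ∈ I) (t : ℕ) (x : R ⧸ I ^ t) : f ^ t • x = 0 := by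
  obtain ⟨x, rfl⟩ := Submodule.Quotient.mk_surjective _ x
  rw [← Submodule.Quotient.mk_smul, Submodule.Quotient.mk_eq_zero, smul_eq_mul]
  exact Ideal.mul_mem_right _ _ (Ideal.pow_mem_pow hf t)

/-- The short complex `N → N_f → T_f N`. -/
noncomputable abbrev scT (f : R) (N : Type) [AddCommGroup N] [Module R N] :
    ShortComplex (ModuleCat.{0} R) :=
  ShortComplex.mk (ModuleCat.ofHom (mkf f N))
    (ModuleCat.ofHom (Submodule.mkQ (LinearMap.range (mkf f N))))
    (ses_w (LinearMap.exact_map_mkQ_range _))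

lemma scT_exact (f : R) (h : ∀ n : N, f • n = 0 → n = 0) : (scT f N).ShortExact :=
  ses _ _ (mkf_inj f h) (Submodule.mkQ_surjective _) (LinearMap.exact_map_mkQ_range _) _

/-- The short complex `im N → N_f → T_f N`. -/
noncomputable abbrev scT' (f : R) (N : Type) [AddCommGroup N] [Module R N] :
    ShortComplex (ModuleCat.{0} R) :=
  ShortComplex.mk (ModuleCat.ofHom (Submodule.subtype (LinearMap.range (mkf f N))))
    (ModuleCat.ofHom (Submodule.mkQ (LinearMap.range (mkf f N))))
    (ses_w (LinearMap.exact_subtype_mkQ _))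

lemma scT'_exact (f : R) : (scT' f N).ShortExact :=
  ses _ _ (Submodule.subtype_injective _) (Submodule.mkQ_surjective _)
    (LinearMap.exact_subtype_mkQ _) _

lemma exact_ker_rangeRestrict (f : R) : Function.Exact (Submodule.subtype (LinearMap.ker (mkf f N)))
    (LinearMap.rangeRestrict (mkf f N)) := by
  rw [LinearMap.exact_iff, LinearMap.ker_rangeRestrict, Submodule.range_subtype]

/-- The short complex `ker → N → im N`. -/
noncomputable abbrev scK (f : R) (N : Type) [AddCommGroup N] [Module R N] :
    ShortComplex (ModuleCat.{0} R) :=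
  ShortComplex.mk (ModuleCat.ofHom (Submodule.subtype (LinearMap.ker (mkf f N))))
    (ModuleCat.ofHom (LinearMap.rangeRestrict (mkf f N)))
    (ses_w (exact_ker_rangeRestrict f))

lemma scK_exact (f : R) : (scK f N).ShortExact :=
  ses _ _ (Submodule.subtype_injective _) (LinearMap.surjective_rangeRestrict _)
    (exact_ker_rangeRestrict f) _

lemma tors_of_three [IsNoetherianRing R] (f1 f2 f3 : R) (m : M) (h1 : ∃ s : ℕ, f1 ^ s • m = 0)
    (h2 : ∃ s : ℕ, f2 ^ s • m = 0) (h3 : ∃ s : ℕ, f3 ^ s • m = 0) :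
    ∃ s : ℕ, ∀ a ∈ (Ideal.span {f1, f2, f3} : Ideal R) ^ s, a • m = 0 := by
  let A : Ideal R := LinearMap.ker (LinearMap.toSpanSingleton R M m)
  have hA : Ideal.span {f1, f2, f3} ≤ A.radical := by
    rw [Ideal.span_le]
    rintro x (rfl | rfl | rfl)
    · exact h1
    · exact h2
    · exact h3
  obtain ⟨s, hs⟩ := Ideal.exists_pow_le_of_le_radical_of_fg hA (IsNoetherian.noetherian _)
  exact ⟨s, fun a ha => hs ha⟩

theorem unified [IsNoetherianRing R] (f1 f2 f3 : R) (I : Ideal R) (hI : I = Ideal.span {f1, f2, f3})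
    (h1 : ∀ m : M, f1 • m = 0 → m = 0) (h2 : ∀ m : TL f1 M, f2 • m = 0 → m = 0) (r : R)
    (hr : ∀ m : TL f3 (TL f2 (TL f1 M)), r • m = 0 → m = 0) (t : ℕ)
    (x : Abelian.Ext (ModuleCat.of R (R ⧸ I ^ t)) (ModuleCat.of R M) 3) (hx : r • x = 0) :
    ∃ (t' : ℕ) (h : t ≤ t'), (Abelian.Ext.mk₀ (prj I h)).comp x (zero_add _) = 0 := by
  have m1 : f1 ∈ I := hI ▸ Ideal.subset_span (by simp)
  have m2 : f2 ∈ I := hI ▸ Ideal.subset_span (by simp)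
  have m3 : f3 ∈ I := hI ▸ Ideal.subset_span (by simp)
  obtain ⟨y1, hy1, hr1⟩ := dimShift (scT_exact f1 h1)
    (fun i x => ext_vanish f1 t (kill_quot I f1 m1 t) (Lf_bij f1) x) r x hx
  obtain ⟨y2, hy2, hr2⟩ := dimShift (scT_exact f2 h2)
    (fun i x => ext_vanish f2 t (kill_quot I f2 m2 t) (Lf_bij f2) x) r y1 hr1
  let N' := TL f2 (TL f1 M)
  have hK := scK_exact (N := N') f3
  let y3 : Abelian.Ext _ (scK f3 N').X₃ 1 := Abelian.Ext.comp y2 (Abelian.Ext.mk₀ (scK f3 N').g) (add_zero 1)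
  have hr3 : r • y3 = 0 := by
    change r • Abelian.Ext.comp y2 _ _ = 0
    rw [← Abelian.Ext.smul_comp, hr2, Abelian.Ext.zero_comp]
  obtain ⟨h, hh, hrh⟩ := dimShift (scT'_exact (N := N') f3)
    (fun i x => ext_vanish f3 t (kill_quot I f3 m3 t) (Lf_bij f3) x) r y3 hr3
  obtain ⟨h', rfl⟩ := (Abelian.Ext.mk₀_bijective _ _).2 h
  have h0 : h' = 0 := by
    rw [← Abelian.Ext.mk₀_smul, Abelian.Ext.mk₀_eq_zero_iff] at hrh
    apply ModuleCat.hom_ext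
    apply LinearMap.ext
    intro z
    apply hr
    exact congrArg (fun k => k.hom z) hrh
  have hy3 : y3 = 0 := by
    rw [← hh, h0, Abelian.Ext.mk₀_zero, Abelian.Ext.zero_comp]
  obtain ⟨k, hk⟩ := Abelian.Ext.covariant_sequence_exact₂ _ hK y2 hy3
  obtain ⟨t', htt, hk'⟩ := torsion_ext_one I (scK f3 N').X₁ (by
    rintro ⟨m, hm⟩
    obtain ⟨s, hs⟩ := tors_of_three f1 f2 f3 m (TL_tors' _ _ (TL_tors f1) m) (TL_tors _ m)
      (mkf_ker hm)
    rw [hI]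
    exact ⟨s, fun a ha => Subtype.ext (hs a ha)⟩) t k
  refine ⟨t', htt, ?_⟩
  rw [← hy1, ← hy2, ← hk]
  rw [← Abelian.Ext.comp_assoc _ _ _ (zero_add 2) rfl (by norm_num),
    ← Abelian.Ext.comp_assoc _ _ _ (zero_add 1) rfl (by norm_num),
    ← Abelian.Ext.comp_assoc _ _ _ (zero_add 1) (add_zero 1) (by norm_num), hk',
    Abelian.Ext.zero_comp, Abelian.Ext.zero_comp, Abelian.Ext.zero_comp]
end Uni
end H3

end

section
open CategoryTheory Limits Opposite

namespace H3
section Repr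
variable {R : Type} [CommRing R]
variable {M N : Type} [AddCommGroup N] [Module R N] [AddCommGroup M] [Module R M]

/-- `N` consists of the fractions `m / g^t`, with known zero criterion. -/
structure Rep (M N : Type) [AddCommGroup N] [Module R N] [AddCommGroup M] [Module R M]
    (g : R) (J : ℕ → Submodule R M) where
  φ : ℕ → M →ₗ[R] N
  surj : ∀ n, ∃ t m, φ t m = n
  compat : ∀ t s m, φ t m = φ (t + s) (g ^ s • m)
  zero : ∀ t m, φ t m = 0 ↔ ∃ s, g ^ s • m ∈ J (t + s)
  mono : ∀ t m, m ∈ J t → g • m ∈ J (t + 1)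

lemma Rep.mono' {g : R} {J : ℕ → Submodule R M} (P : Rep M N g J) (t s : ℕ) (m : M)
    (hm : m ∈ J t) : g ^ s • m ∈ J (t + s) := by
  induction s with
  | zero => simpa using hm
  | succ s ih =>
    rw [pow_succ', mul_smul, ← add_assoc]
    exact P.mono _ _ ih

/-- The trivial representation. -/
def Rep.base : Rep (R := R) M M 1 (fun _ => ⊥) where
  φ _ := LinearMap.id
  surj n := ⟨0, n, rfl⟩
  compat t s m := by simp
  zero t m := by simp
  mono t m hm := by simpa using hm

/-- The submodule `f M`. -/
abbrev mulSub (f : R) (M : Type) [AddCommGroup M] [Module R M] : Submodule R M :=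
  LinearMap.range (LinearMap.lsmul R M f)

/-- The class of `n / f^t` in `T_f N`. -/
noncomputable def frT (f : R) (t : ℕ) : N →ₗ[R] TL f N :=
  (Submodule.mkQ (LinearMap.range (mkf f N))).comp
    (LocalizedModule.divBy (⟨f ^ t, t, rfl⟩ : Submonoid.powers f) ∘ₗ mkf f N)

lemma frT_eq (f : R) (t : ℕ) (n : N) : frT f t n = Submodule.Quotient.mk (fr f t n) := by
  simp only [frT, LinearMap.comp_apply, LocalizedModule.divBy_apply, fr,
    LocalizedModule.mkLinearMap_apply, LocalizedModule.liftOn_mk, one_mul]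
  rfl

lemma fr_compat (f : R) (t s : ℕ) (n : N) : fr f t n = fr f (t + s) (f ^ s • n) := by
  rw [fr, fr, LocalizedModule.mk_eq]
  refine ⟨1, ?_⟩
  simp only [one_smul, Submonoid.smul_def, smul_smul, pow_add]

lemma frT_zero (f : R) (t : ℕ) (n : N) :
    frT f t n = 0 ↔ ∃ (n' : N) (s : ℕ), f ^ s • n = f ^ (s + t) • n' := by
  rw [frT_eq, Submodule.Quotient.mk_eq_zero, LinearMap.mem_range]
  refine exists_congr fun n' => ?_
  rw [LocalizedModule.mkLinearMap_apply, fr, LocalizedModule.mk_eq]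
  constructor
  · rintro ⟨⟨_, s, rfl⟩, hs⟩
    refine ⟨s, ?_⟩
    simp only [one_smul, Submonoid.smul_def, smul_smul, ← pow_add] at hs
    exact hs.symm
  · rintro ⟨s, hs⟩
    refine ⟨⟨_, s, rfl⟩, ?_⟩
    simp only [one_smul, Submonoid.smul_def, smul_smul, ← pow_add]
    exact hs.symm

/-- Representation of `T_f N`. -/
noncomputable def Rep.step {g : R} {J : ℕ → Submodule R M} (P : Rep M N g J) (f : R) :
    Rep M (TL f N) (g * f) (fun t => J t ⊔ mulSub (f ^ t) M) where
  φ t := (frT f t).comp (P.φ t)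
  surj n := by
    obtain ⟨x, rfl⟩ := Submodule.Quotient.mk_surjective _ n
    obtain ⟨t, n, rfl⟩ := fr_surj f x
    obtain ⟨t', m, rfl⟩ := P.surj n
    refine ⟨t + t', f ^ t' • g ^ t • m, ?_⟩
    rw [LinearMap.comp_apply, frT_eq, fr_compat f t t', P.compat t' t, map_smul, add_comm t' t]
  compat t s m := by
    rw [LinearMap.comp_apply, LinearMap.comp_apply, frT_eq, frT_eq, fr_compat f t s,
      P.compat t s, mul_pow, mul_comm (g ^ s), mul_smul, map_smul (P.φ (t + s)) (f ^ s)]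
  mono t m hm := by
    obtain ⟨a, ha, _, ⟨b, rfl⟩, rfl⟩ := Submodule.mem_sup.1 hm
    rw [smul_add]
    refine Submodule.add_mem_sup ?_ ⟨g • b, ?_⟩
    · rw [mul_comm, mul_smul]
      exact Submodule.smul_mem _ _ (P.mono t a ha)
    · simp only [LinearMap.lsmul_apply, smul_smul]
      congr 1
      ring
  zero t m := by
    rw [LinearMap.comp_apply, frT_zero]
    constructor
    · rintro ⟨n', s, h⟩
      obtain ⟨t', m', rfl⟩ := P.surj n'
      rw [P.compat t t' m, P.compat t' t m', add_comm t' t, ← map_smul, ← map_smul, ← sub_eq_zero,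
        ← map_sub, P.zero] at h
      obtain ⟨k, hk⟩ := h
      refine ⟨s + t' + k, ?_⟩
      have h1 := Submodule.smul_mem _ (f ^ (t' + k)) (P.mono' _ s _ hk)
      have h2 : (g * f) ^ (s + t' + k) • m =
        f ^ (t' + k) • g ^ s • g ^ k • (f ^ s • g ^ t' • m - f ^ (s + t) • g ^ t • m') +
        f ^ (t + (s + t' + k)) • (g ^ (s + k + t) • m') := by
        simp only [smul_sub, smul_smul]
        rw [eq_comm, sub_add_eq_add_sub, sub_eq_iff_eq_add]
        congr 1
        · congr 1; ring
        · congr 1; ring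
      rw [h2]
      refine Submodule.add_mem_sup ?_ ⟨_, rfl⟩
      convert h1 using 2
      ring
    · rintro ⟨s, h⟩
      obtain ⟨a, ha, _, ⟨b, rfl⟩, hab⟩ := Submodule.mem_sup.1 h
      rw [LinearMap.lsmul_apply] at hab
      have h0 : P.φ (t + s) a = 0 := (P.zero _ _).2 ⟨0, by simpa using ha⟩
      refine ⟨P.φ (t + s) b, s, ?_⟩
      rw [P.compat t s, ← map_smul, smul_smul, ← mul_pow, mul_comm f g, ← hab, map_add, h0, zero_add,
        map_smul, add_comm s t]

theorem unified' [IsNoetherianRing R] (f1 f2 f3 : R) (I : Ideal R) (hI : I = Ideal.span {f1, f2, f3})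
    (h1 : ∀ m : M, f1 • m = 0 → m = 0) (h2 : ∀ m b : M, f2 • m = f1 • b → ∃ c, m = f1 • c) (r : R)
    (hr : ∀ (t : ℕ) (m a b c : M), r • m = f1 ^ t • a + f2 ^ t • b + f3 ^ t • c →
      ∃ s, ∃ a b c : M,
        (f1 * f2 * f3) ^ s • m = f1 ^ (t + s) • a + f2 ^ (t + s) • b + f3 ^ (t + s) • c) (t : ℕ)
    (x : Abelian.Ext (ModuleCat.of R (R ⧸ I ^ t)) (ModuleCat.of R M) 3) (hx : r • x = 0) :
    ∃ (t' : ℕ) (h : t ≤ t'), (Abelian.Ext.mk₀ (prj I h)).comp x (zero_add _) = 0 := by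
  have h1' : ∀ (t : ℕ) (m : M), f1 ^ t • m = 0 → m = 0 := by
    intro t
    induction t with
    | zero => intro m hm; simpa using hm
    | succ t ih => intro m hm; apply h1; apply ih; rwa [smul_smul, ← pow_succ]
  have h2' : ∀ (t : ℕ) (m b : M), f2 • m = f1 ^ t • b → ∃ c, m = f1 ^ t • c := by
    intro t
    induction t with
    | zero => intro m b _; exact ⟨m, by simp⟩
    | succ t ih =>
      intro m b h
      rw [pow_succ', mul_smul] at h
      obtain ⟨c, rfl⟩ := h2 _ _ h
      rw [smul_comm, ← sub_eq_zero, ← smul_sub] at h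
      obtain ⟨d, rfl⟩ := ih c b (sub_eq_zero.1 (h1 _ h))
      exact ⟨d, by rw [pow_succ', mul_smul]⟩
  let P1 := (Rep.base (R := R) (M := M)).step f1
  let P3 := (P1.step f2).step f3
  refine unified f1 f2 f3 I hI h1 ?_ r ?_ t x hx
  · intro m hm
    obtain ⟨t, m, rfl⟩ := P1.surj m
    rw [← map_smul, P1.zero] at hm
    rw [P1.zero]
    obtain ⟨s, hs⟩ := hm
    refine ⟨s, ?_⟩
    simp only [bot_sup_eq, one_mul, LinearMap.mem_range, LinearMap.lsmul_apply] at hs ⊢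
    obtain ⟨b, hb⟩ := hs
    rw [smul_comm] at hb
    obtain ⟨c, hc⟩ := h2' _ _ _ hb.symm
    exact ⟨c, hc.symm⟩
  · intro m hm
    obtain ⟨t, m, rfl⟩ := P3.surj m
    rw [← map_smul, P3.zero] at hm
    obtain ⟨s, hs⟩ := hm
    rw [P3.compat t s]
    rw [smul_comm] at hs
    rw [P3.zero]
    simp only [bot_sup_eq, one_mul] at hs ⊢
    obtain ⟨ab, hab, _, ⟨c, rfl⟩, hs⟩ := Submodule.mem_sup.1 hs
    obtain ⟨_, ⟨a, rfl⟩, _, ⟨b, rfl⟩, rfl⟩ := Submodule.mem_sup.1 hab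
    obtain ⟨s', a', b', c', h⟩ := hr _ _ _ _ _ hs.symm
    refine ⟨s', ?_⟩
    rw [h]
    exact Submodule.add_mem_sup (Submodule.add_mem_sup ⟨_, rfl⟩ ⟨_, rfl⟩) ⟨_, rfl⟩
end Repr
end H3

end

section
open CategoryTheory Limits Opposite

namespace H3
section Final
variable {R : Type} [CommRing R] {S : Type} [CommRing S] [Algebra R S]

theorem bij_of_facts [IsNoetherianRing R] (f1 f2 f3 : R) (I : Ideal R)
    (hI : I = Ideal.span {f1, f2, f3}) (p : ℤ)
    (hp : ∀ a : R, (p : R) * a = 0 → a = 0)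
    (hS : Function.Surjective (algebraMap R S))
    (hSp : ∀ a : R, algebraMap R S a = 0 ↔ ∃ b, a = p * b)
    (h1 : ∀ m : R, f1 * m = 0 → m = 0) (h2 : ∀ m b : R, f2 * m = f1 * b → ∃ c, m = f1 * c)
    (h1S : ∀ m : S, algebraMap R S f1 * m = 0 → m = 0)
    (h2S : ∀ m b : S, algebraMap R S f2 * m = algebraMap R S f1 * b →
      ∃ c, m = algebraMap R S f1 * c)
    (hr : ∀ (t : ℕ) (m a b c : R), p * m = f1 ^ t * a + f2 ^ t * b + f3 ^ t * c →
      ∃ s, ∃ a b c : R,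
        (f1 * f2 * f3) ^ s * m = f1 ^ (t + s) * a + f2 ^ (t + s) * b + f3 ^ (t + s) * c)
    (hrS : ∀ (t : ℕ) (m : S), ∃ s, ∃ a b c : S,
        algebraMap R S (f1 * f2 * f3) ^ s * m =
          algebraMap R S f1 ^ (t + s) * a + algebraMap R S f2 ^ (t + s) * b +
          algebraMap R S f3 ^ (t + s) * c) :
    Function.Bijective (fun m : (localCohomology I 3).obj (ModuleCat.of R R) => p • m) := by
  let mp : R →ₗ[R] R := LinearMap.lsmul R R (p : R)
  have hex : Function.Exact mp (Algebra.linearMap R S) := by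
    intro a
    rw [Algebra.linearMap_apply, hSp]
    constructor
    · rintro ⟨b, rfl⟩; exact ⟨b, rfl⟩
    · rintro ⟨b, rfl⟩; exact ⟨b, rfl⟩
  have hse := ses mp (Algebra.linearMap R S)
    ((injective_iff_map_eq_zero mp).2 hp) hS hex (ses_w hex)
  refine bij_of_ext I _ p 2 ?_ ?_
  · intro t x hx
    refine unified' f1 f2 f3 I hI h1 h2 (p : R) hr t x ?_
    rw [Int.cast_smul_eq_zsmul]
    exact hx
  · intro t x
    obtain ⟨t', h, hx⟩ := unified' f1 f2 f3 I hI (M := S)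
      (fun m hm => h1S m (by rwa [Algebra.smul_def] at hm))
      (fun m b hm => by
        simp only [Algebra.smul_def] at hm ⊢
        exact h2S m b hm) 0
      (fun t m a b c _ => by
        simp only [Algebra.smul_def, map_pow]
        exact hrS t m) t
      (x.comp (Abelian.Ext.mk₀ (ModuleCat.ofHom (Algebra.linearMap R S))) (add_zero _)) (zero_smul _ _)
    refine ⟨t', h, ?_⟩
    rw [← Abelian.Ext.comp_assoc _ _ _ (zero_add 3) (add_zero 3) (by norm_num)] at hx
    obtain ⟨y, hy⟩ := Abelian.Ext.covariant_sequence_exact₂ _ hse _ hx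
    refine ⟨y, ?_⟩
    rw [← hy, ← Int.cast_smul_eq_zsmul R, Abelian.Ext.smul_eq_comp_mk₀]
    rfl
end Final
end H3

end

section
open MvPolynomial

namespace H3
section Conc

/-- The polynomial ring in six variables. -/
abbrev A6 (k : Type) [CommRing k] : Type := MvPolynomial (Fin 6) k

/-- First minor. -/
noncomputable def D1 (k : Type) [CommRing k] : A6 k := X 1 * X 5 - X 2 * X 4
/-- Second minor. -/
noncomputable def D2 (k : Type) [CommRing k] : A6 k := X 2 * X 3 - X 0 * X 5
/-- Third minor. -/
noncomputable def D3 (k : Type) [CommRing k] : A6 k := X 0 * X 4 - X 1 * X 3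

lemma rel1 (k : Type) [CommRing k] : X 0 * D1 k + X 1 * D2 k + X 2 * D3 k = 0 := by
  unfold D1 D2 D3; ring

lemma rel2 (k : Type) [CommRing k] : X 3 * D1 k + X 4 * D2 k + X 5 * D3 k = 0 := by
  unfold D1 D2 D3; ring

lemma prime_D1 (k : Type) [CommRing k] [IsDomain k] [UniqueFactorizationMonoid k] :
    Prime (D1 k) := by
  rw [← UniqueFactorizationMonoid.irreducible_iff_prime]
  have h : D1 k = X 1 * X 5 + (- (X 2 * X 4)) := by unfold D1; ring
  rw [h]
  apply irreducible_mul_X_add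
  · exact X_ne_zero _
  · simp [vars_X]
  · rw [vars_neg]
    intro hm
    have := vars_mul _ _ hm
    simp [vars_X] at this
  · rw [Irreducible.isRelPrime_iff_not_dvd (X_prime).irreducible]
    rintro ⟨c, hc⟩
    have := congrArg (aeval (fun i : Fin 6 => if i = 1 then (0 : k) else 1)) hc
    simp at this

lemma D1_not_dvd (k : Type) [CommRing k] [IsDomain k] (f : A6 k)
    (hf : aeval (fun i : Fin 6 => if i = 2 ∨ i = 3 then (1 : k) else 0) f ≠ 0) : ¬ D1 k ∣ f := by
  rintro ⟨c, rfl⟩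
  apply hf
  rw [map_mul]
  simp [D1]

lemma D1_cancel (k : Type) [CommRing k] [IsDomain k] [UniqueFactorizationMonoid k] (m b : A6 k)
    (h : D2 k * m = D1 k * b) : ∃ c, m = D1 k * c := by
  have h1 : D1 k ∣ D2 k * m := ⟨b, h⟩
  rcases (prime_D1 k).dvd_or_dvd h1 with h2 | h2
  · exact absurd h2 (D1_not_dvd k _ (by simp [D2]))
  · exact h2

lemma D1_cancel' (k : Type) [CommRing k] [IsDomain k] [UniqueFactorizationMonoid k] (m b : A6 k)
    (h : (X 2 * X 3) * m = D1 k * b) : ∃ c, m = D1 k * c := by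
  have h1 : D1 k ∣ (X 2 * X 3) * m := ⟨b, h⟩
  rcases (prime_D1 k).dvd_or_dvd h1 with h2 | h2
  · exact absurd h2 (D1_not_dvd k _ (by simp))
  · exact h2

lemma D1_ne (k : Type) [CommRing k] [IsDomain k] [UniqueFactorizationMonoid k] : D1 k ≠ 0 :=
  (prime_D1 k).ne_zero

lemma D2_ne (k : Type) [CommRing k] [IsDomain k] : D2 k ≠ 0 := by
  intro h
  have := congrArg (aeval (fun i : Fin 6 => if i = 2 ∨ i = 3 then (1 : k) else 0)) h
  simp [D2] at this

lemma D3_ne (k : Type) [CommRing k] [IsDomain k] : D3 k ≠ 0 := by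
  intro h
  have := congrArg (aeval (fun i : Fin 6 => if i = 1 ∨ i = 3 then (1 : k) else 0)) h
  simp [D3] at this

/-- Hilbert–Burch for a `2 × 3` matrix. -/
lemma hilbert_burch {A : Type} [CommRing A] [IsDomain A] (u v w x y z d1 d2 d3 : A)
    (e1 : d1 = v * z - w * y) (e2 : d2 = w * x - u * z) (e3 : d3 = u * y - v * x)
    (h1 : d1 ≠ 0) (h2 : ∀ m b, d2 * m = d1 * b → ∃ c, m = d1 * c) (g1 g2 g3 : A)
    (hg : g1 * d1 + g2 * d2 + g3 * d3 = 0) :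
    ∃ α β, g1 = α * u + β * x ∧ g2 = α * v + β * y ∧ g3 = α * w + β * z := by
  obtain ⟨α, hα⟩ := h2 (g2 * z - g3 * y) (g3 * x - g1 * z) (by
    have : d2 * (g2 * z - g3 * y) - d1 * (g3 * x - g1 * z) =
      z * (g1 * d1 + g2 * d2 + g3 * d3) := by rw [e1, e2, e3]; ring
    rw [hg, mul_zero] at this
    exact sub_eq_zero.1 this)
  obtain ⟨β, hβ⟩ := h2 (v * g3 - w * g2) (w * g1 - u * g3) (by
    have : d2 * (v * g3 - w * g2) - d1 * (w * g1 - u * g3) =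
      - w * (g1 * d1 + g2 * d2 + g3 * d3) := by rw [e1, e2, e3]; ring
    rw [hg, mul_zero] at this
    exact sub_eq_zero.1 this)
  have k2 : g2 = α * v + β * y := by
    apply mul_left_cancel₀ h1
    linear_combination g2 * e1 + v * hα + y * hβ
  have k3 : g3 = α * w + β * z := by
    apply mul_left_cancel₀ h1
    linear_combination g3 * e1 + w * hα + z * hβ
  refine ⟨α, β, ?_, k2, k3⟩
  apply mul_left_cancel₀ h1
  rw [k2, k3] at hg
  rw [e1, e2, e3] at *
  linear_combination hg

lemma hb (k : Type) [CommRing k] [IsDomain k] [UniqueFactorizationMonoid k] (g1 g2 g3 : A6 k)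
    (hg : g1 * D1 k + g2 * D2 k + g3 * D3 k = 0) :
    ∃ α β, g1 = α * X 0 + β * X 3 ∧ g2 = α * X 1 + β * X 4 ∧ g3 = α * X 2 + β * X 5 :=
  hilbert_burch _ _ _ _ _ _ _ _ _ rfl rfl rfl (D1_ne k) (D1_cancel k) g1 g2 g3 hg

/-- Setting `u = 0`. -/
noncomputable def sig (k : Type) [CommRing k] : A6 k →ₐ[k] A6 k :=
  aeval (fun i => if i = 0 then 0 else X i)

lemma sig_spec (k : Type) [CommRing k] (f : A6 k) : ∃ f', f = sig k f + X 0 * f' := by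
  have h : (Ideal.Quotient.mkₐ k (Ideal.span {(X 0 : A6 k)})).comp (sig k) =
      Ideal.Quotient.mkₐ k (Ideal.span {(X 0 : A6 k)}) := by
    apply MvPolynomial.algHom_ext
    intro i
    simp only [sig, AlgHom.comp_apply, aeval_X]
    split_ifs with hi
    · subst hi
      rw [map_zero, eq_comm]
      exact Ideal.Quotient.eq_zero_iff_mem.2 (Ideal.subset_span rfl)
    · rfl
  have h2 := Ideal.Quotient.eq.1 (DFunLike.congr_fun h f)
  obtain ⟨c, hc⟩ := Ideal.mem_span_singleton.1 h2
  change sig k f - f = X 0 * c at hc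
  exact ⟨-c, by linear_combination -hc⟩

lemma u_cancel (k : Type) [CommRing k] [IsDomain k] [UniqueFactorizationMonoid k]
    (g c1 c2 c3 : A6 k) (h : X 0 * g = D1 k * c1 + D2 k * c2 + D3 k * c3) :
    ∃ a b c, g = D1 k * a + D2 k * b + D3 k * c := by
  obtain ⟨b1, h1⟩ := sig_spec k c1
  obtain ⟨b2, h2⟩ := sig_spec k c2
  obtain ⟨b3, h3⟩ := sig_spec k c3
  have hs := congrArg (sig k) h
  have s0 : sig k (X 0) = 0 := by simp [sig]
  have s1 : sig k (D1 k) = X 1 * X 5 - X 2 * X 4 := by simp [sig, D1]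
  have s2 : sig k (D2 k) = X 2 * X 3 := by simp [sig, D2]
  have s3 : sig k (D3 k) = - (X 1 * X 3) := by simp [sig, D3]
  rw [map_mul, s0, map_add, map_add, map_mul, map_mul, map_mul, s1, s2, s3] at hs
  obtain ⟨α, β, k1, k2, k3⟩ := hilbert_burch (0 : A6 k) (X 1) (X 2) (X 3) (X 4) (X 5)
    (D1 k) (X 2 * X 3) (-(X 1 * X 3)) rfl (by ring) (by ring) (D1_ne k) (D1_cancel' k)
    (sig k c1) (sig k c2) (sig k c3) (by unfold D1; linear_combination -hs)
  refine ⟨b1 - α, b2, b3, ?_⟩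
  apply mul_left_cancel₀ (X_ne_zero (R := k) (0 : Fin 6))
  rw [h]
  linear_combination D1 k * (h1 + k1) + D2 k * (h2 + k2) + D3 k * (h3 + k3) + α * rel1 k + β * rel2 k

end Conc
end H3

end

section
open MvPolynomial

namespace H3
section Frob

/-- Remainder exponents. -/
def remE (q : ℕ) (n : Fin 6 →₀ ℕ) (m : Fin 6 → Fin q) : Prop := ∀ i, n i % q = m i

/-- Quotient exponents. -/
noncomputable def quoE (q : ℕ) (n : Fin 6 →₀ ℕ) : Fin 6 →₀ ℕ := n.mapRange (· / q) (Nat.zero_div q)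

open Classical in
/-- The components of a polynomial with respect to the basis of `A6 k` over `q`-th powers. -/
noncomputable def comp (k : Type) [CommRing k] (q : ℕ) (m : Fin 6 → Fin q) : A6 k →ₗ[k] A6 k :=
  (basisMonomials (Fin 6) k).constr k
    (fun n => if remE q n m then monomial (quoE q n) 1 else 0)

open Classical in
lemma comp_mon (k : Type) [CommRing k] (q : ℕ) (m : Fin 6 → Fin q) (n : Fin 6 →₀ ℕ) :
    comp k q m (monomial n 1) = if remE q n m then monomial (quoE q n) 1 else 0 := by
  have := (basisMonomials (Fin 6) k).constr_basis k
    (fun n => if remE q n m then (monomial (quoE q n) 1 : A6 k) else 0) n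
  rwa [coe_basisMonomials] at this

open Classical in
lemma comp_mon' (k : Type) [CommRing k] (q : ℕ) (m : Fin 6 → Fin q) (n : Fin 6 →₀ ℕ) (c : k) :
    comp k q m (monomial n c) = if remE q n m then monomial (quoE q n) c else 0 := by
  have : (monomial n c : A6 k) = c • monomial n 1 := by rw [smul_monomial, smul_eq_mul, mul_one]
  rw [this, map_smul, comp_mon]
  split_ifs
  · rw [smul_monomial, smul_eq_mul, mul_one]
  · rw [smul_zero]

lemma comp_expand (k : Type) [CommRing k] (q : ℕ) (hq : 0 < q) (m : Fin 6 → Fin q) (g f : A6 k) :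
    comp k q m (expand q g * f) = g * comp k q m f := by
  classical
  induction g using MvPolynomial.induction_on' with
  | add g g' h h' => rw [map_add, add_mul, map_add, h, h', add_mul]
  | monomial a c =>
    induction f using MvPolynomial.induction_on' with
    | add f f' h h' => rw [mul_add, map_add, map_add, h, h', mul_add]
    | monomial b d =>
      rw [expand_monomial, monomial_mul, comp_mon', comp_mon']
      have e1 : remE q (q • a + b) m ↔ remE q b m := by
        simp [remE]
      have e2 : quoE q (q • a + b) = a + quoE q b := by
        ext i
        simp [quoE, Nat.mul_add_div hq]
      simp only [e1, e2]
      split_ifs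
      · rw [monomial_mul]
      · rw [mul_zero]

lemma comp_sum (k : Type) [CommRing k] (q : ℕ) (hq : 0 < q) (f : A6 k) :
    f = ∑ m : Fin 6 → Fin q, (∏ i, X i ^ (m i : ℕ)) * expand q (comp k q m f) := by
  classical
  let B : A6 k →ₗ[k] A6 k := ∑ m : Fin 6 → Fin q,
    (LinearMap.mul k (A6 k) (∏ i, X i ^ (m i : ℕ))).comp ((expand q).toLinearMap.comp (comp k q m))
  have h : LinearMap.id = B := by
    refine (basisMonomials (Fin 6) k).ext fun a => ?_
    simp only [coe_basisMonomials, B, LinearMap.sum_apply, LinearMap.comp_apply, comp_mon]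
    rw [Finset.sum_eq_single (fun i => ⟨a i % q, Nat.mod_lt _ hq⟩)]
    · rw [if_pos (show remE q a _ from fun i => rfl)]
      simp only [LinearMap.id_apply, AlgHom.toLinearMap_apply, LinearMap.mul_apply']
      rw [expand_monomial, monomial_eq, monomial_eq]
      rw [Finsupp.prod_fintype _ _ (by simp), Finsupp.prod_fintype _ _ (by simp)]
      simp only [map_one, one_mul, ← Finset.prod_mul_distrib, ← pow_add]
      refine Finset.prod_congr rfl fun i _ => ?_
      congr 1
      simp [quoE, Nat.mod_add_div]
    · intro m _ hm
      rw [if_neg]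
      · simp
      · intro h
        apply hm
        funext i
        exact Fin.ext (h i).symm
    · simp
  have := congrArg (fun B => B f) h
  simpa [B] using this

variable (p : ℕ) [hp : Fact p.Prime]

lemma expand_pow (e : ℕ) (f : A6 (ZMod p)) : expand (p ^ e) f = f ^ (p ^ e) := by
  induction e with
  | zero => simp
  | succ e ih => rw [pow_succ, expand_mul, expand_zmod, map_pow, ih, pow_mul]

lemma comp_pow (e : ℕ) (m : Fin 6 → Fin (p ^ e)) (g f : A6 (ZMod p)) :
    comp _ (p ^ e) m (g ^ (p ^ e) * f) = g * comp _ (p ^ e) m f := by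
  rw [← expand_pow, comp_expand _ _ (pow_pos hp.out.pos _)]

lemma comp_sum_pow (e : ℕ) (f : A6 (ZMod p)) :
    f = ∑ m : Fin 6 → Fin (p ^ e), (∏ i, X i ^ (m i : ℕ)) * (comp _ (p ^ e) m f) ^ (p ^ e) := by
  conv_lhs => rw [comp_sum _ (p ^ e) (pow_pos hp.out.pos _) f]
  simp only [expand_pow]

lemma syz (e : ℕ) (g1 g2 g3 : A6 (ZMod p))
    (h : g1 * D1 (ZMod p) ^ p ^ e + g2 * D2 (ZMod p) ^ p ^ e + g3 * D3 (ZMod p) ^ p ^ e = 0) :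
    ∃ α β : A6 (ZMod p), g1 = α * X 0 ^ p ^ e + β * X 3 ^ p ^ e ∧ g2 = α * X 1 ^ p ^ e + β * X 4 ^ p ^ e ∧
      g3 = α * X 2 ^ p ^ e + β * X 5 ^ p ^ e := by
  have h' : ∀ m, ∃ α β : A6 (ZMod p), comp _ (p ^ e) m g1 = α * X 0 + β * X 3 ∧
      comp _ (p ^ e) m g2 = α * X 1 + β * X 4 ∧ comp _ (p ^ e) m g3 = α * X 2 + β * X 5 := by
    intro m
    apply hb
    have := congrArg (comp _ (p ^ e) m) h
    rw [mul_comm g1, mul_comm g2, mul_comm g3, map_add, map_add, comp_pow, comp_pow, comp_pow,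
      map_zero] at this
    linear_combination this
  choose α β k1 k2 k3 using h'
  have key : ∀ (g a b : A6 (ZMod p)), (∀ m, comp _ (p ^ e) m g = α m * a + β m * b) →
      g = (∑ m, (∏ i, X i ^ (m i : ℕ)) * (α m) ^ (p ^ e)) * a ^ p ^ e +
        (∑ m, (∏ i, X i ^ (m i : ℕ)) * (β m) ^ (p ^ e)) * b ^ p ^ e := by
    intro g a b hg
    conv_lhs => rw [comp_sum_pow p e g]
    rw [Finset.sum_mul, Finset.sum_mul, ← Finset.sum_add_distrib]
    refine Finset.sum_congr rfl fun m _ => ?_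
    rw [hg, add_pow_char_pow, mul_pow, mul_pow]
    ring
  exact ⟨_, _, key _ _ _ k1, key _ _ _ k2, key _ _ _ k3⟩

lemma u_cancel_pow (e : ℕ) (g c1 c2 c3 : A6 (ZMod p))
    (h : X 0 ^ p ^ e * g =
      D1 (ZMod p) ^ p ^ e * c1 + D2 (ZMod p) ^ p ^ e * c2 + D3 (ZMod p) ^ p ^ e * c3) :
    ∃ a b c, g = D1 (ZMod p) ^ p ^ e * a + D2 (ZMod p) ^ p ^ e * b + D3 (ZMod p) ^ p ^ e * c := by
  have h' : ∀ m, ∃ a b c, comp _ (p ^ e) m g =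
      D1 (ZMod p) * a + D2 (ZMod p) * b + D3 (ZMod p) * c := by
    intro m
    have := congrArg (comp _ (p ^ e) m) h
    rw [map_add, map_add, comp_pow, comp_pow, comp_pow, comp_pow] at this
    exact u_cancel _ _ _ _ _ this
  choose a b c k1 using h'
  refine ⟨∑ m, (∏ i, X i ^ (m i : ℕ)) * (a m) ^ (p ^ e),
    ∑ m, (∏ i, X i ^ (m i : ℕ)) * (b m) ^ (p ^ e),
    ∑ m, (∏ i, X i ^ (m i : ℕ)) * (c m) ^ (p ^ e), ?_⟩
  conv_lhs => rw [comp_sum_pow p e g]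
  rw [Finset.mul_sum, Finset.mul_sum, Finset.mul_sum, ← Finset.sum_add_distrib,
    ← Finset.sum_add_distrib]
  refine Finset.sum_congr rfl fun m _ => ?_
  rw [k1, add_pow_char_pow, add_pow_char_pow, mul_pow, mul_pow, mul_pow]
  ring

lemma prod_pow_mem (e : ℕ) : ∃ a b c : A6 (ZMod p),
    (D1 (ZMod p) * D2 (ZMod p) * D3 (ZMod p)) ^ (p ^ e * (p - 1)) =
      D1 (ZMod p) ^ (p ^ e * p) * a + D2 (ZMod p) ^ (p ^ e * p) * b +
      D3 (ZMod p) ^ (p ^ e * p) * c := by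
  obtain ⟨r, hr⟩ : ∃ r, p = r + 2 := ⟨p - 2, by have := hp.out.two_le; omega⟩
  have hr1 : p - 1 = r + 1 := by omega
  have h1 : ∃ a b c : A6 (ZMod p), (D1 (ZMod p) * D2 (ZMod p) * D3 (ZMod p)) ^ (p - 1) =
      D1 (ZMod p) ^ p * a + D2 (ZMod p) ^ p * b + D3 (ZMod p) ^ p * c := by
    have := u_cancel_pow p 1 ((D1 (ZMod p) * D2 (ZMod p) * D3 (ZMod p)) ^ (p - 1)) 0
      (X 0 * (X 0 * D1 (ZMod p)) ^ r * (- X 1) * D3 (ZMod p) ^ (r + 1))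
      (X 0 * (X 0 * D1 (ZMod p)) ^ r * (- X 2) * D2 (ZMod p) ^ (r + 1))
    rw [pow_one] at this
    apply this
    rw [hr1]
    have e2 : ∀ a : A6 (ZMod p), a ^ p = a ^ (r + 2) := fun a => by rw [← hr]
    simp only [e2]
    linear_combination X 0 * (X 0 * D1 (ZMod p)) ^ r * (D2 (ZMod p) * D3 (ZMod p)) ^ (r + 1) *
      rel1 (ZMod p)
  obtain ⟨a, b, c, h⟩ := h1
  refine ⟨a ^ p ^ e, b ^ p ^ e, c ^ p ^ e, ?_⟩
  rw [mul_comm (p ^ e) (p - 1), pow_mul, h, add_pow_char_pow, add_pow_char_pow, mul_pow, mul_pow,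
    mul_pow]
  simp only [← pow_mul, mul_comm p]

lemma vanish_S (t : ℕ) (m : A6 (ZMod p)) : ∃ s, ∃ a b c : A6 (ZMod p),
    (D1 (ZMod p) * D2 (ZMod p) * D3 (ZMod p)) ^ s * m =
      D1 (ZMod p) ^ (t + s) * a + D2 (ZMod p) ^ (t + s) * b + D3 (ZMod p) ^ (t + s) * c := by
  obtain ⟨a, b, c, h⟩ := prod_pow_mem p t
  have ht : t ≤ p ^ t := (Nat.lt_pow_self hp.out.one_lt).le
  have h3 : p ^ t * p = p ^ t * (p - 1) + p ^ t := by
    obtain ⟨r, hr⟩ : ∃ r, p = r + 1 := ⟨p - 1, by have := hp.out.two_le; omega⟩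
    have : p - 1 = r := by omega
    rw [this]
    conv_lhs => rw [mul_comm]
    conv_lhs => enter [1]; rw [hr]
    ring
  let d := (D1 (ZMod p) * D2 (ZMod p) * D3 (ZMod p)) ^ (p ^ t - t) * m
  refine ⟨p ^ t * (p - 1) + (p ^ t - t), a * d, b * d, c * d, ?_⟩
  have h2 : t + (p ^ t * (p - 1) + (p ^ t - t)) = p ^ t * p := by omega
  rw [h2, pow_add, h]
  ring
end Frob
end H3

end

section
open MvPolynomial

namespace H3
section Key

/-- Polynomials all of whose monomials are divisible by some `T_i^q`. -/
noncomputable def tI (B : Type) [CommRing B] (q : ℕ) : Ideal (A6 B) where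
  carrier := {f | ∀ a : Fin 6 →₀ ℕ, (∀ i, a i < q) → coeff a f = 0}
  zero_mem' := fun a _ => coeff_zero a
  add_mem' := fun hf hg a ha => by rw [coeff_add, hf a ha, hg a ha, add_zero]
  smul_mem' := fun c f hf a ha => by
    rw [smul_eq_mul, coeff_mul]
    refine Finset.sum_eq_zero fun x hx => ?_
    rw [hf x.2 (fun i => ?_), mul_zero]
    have := congrArg (fun b : Fin 6 →₀ ℕ => b i) (Finset.HasAntidiagonal.mem_antidiagonal.1 hx)
    simp only [Finsupp.add_apply] at this
    have := ha i
    omega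

lemma mem_tI {B : Type} [CommRing B] {q : ℕ} {f : A6 B} :
    f ∈ tI B q ↔ ∀ a : Fin 6 →₀ ℕ, (∀ i, a i < q) → coeff a f = 0 := Iff.rfl

lemma X_mem_tI (B : Type) [CommRing B] (q : ℕ) (i : Fin 6) : (X i : A6 B) ^ q ∈ tI B q := by
  intro a ha
  rw [coeff_X_pow, if_neg]
  rintro rfl
  have := ha i
  simp at this

/-- The shift `X_i ↦ X_i + T_i`. -/
noncomputable def psi (k : Type) [CommRing k] : A6 k →+* A6 (A6 k) :=
  eval₂Hom (C.comp C) (fun i => C (X i) + X i)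

lemma psi_X (k : Type) [CommRing k] (i : Fin 6) : psi k (X i) = C (X i) + X i := by
  simp [psi]

lemma psi_sub_mem (k : Type) [CommRing k] (J : Ideal (A6 (A6 k))) (hJ : ∀ i, X i ∈ J) (f : A6 k) :
    C f - psi k f ∈ J := by
  rw [← Ideal.Quotient.eq]
  have : (Ideal.Quotient.mk J).comp C = (Ideal.Quotient.mk J).comp (psi k) := by
    apply MvPolynomial.ringHom_ext
    · intro r
      simp [psi]
    · intro i
      simp only [RingHom.comp_apply, psi_X, map_add]
      rw [Ideal.Quotient.eq_zero_iff_mem.2 (hJ i), add_zero]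
  exact DFunLike.congr_fun this f

lemma exists_G (k : Type) [CommRing k] (q : ℕ) (f : A6 k) :
    ∃ N0, ∀ N, N0 ≤ N → ∃ G, psi k f * G - C f ^ N ∈ tI (A6 k) q := by
  obtain ⟨N0, h0⟩ := psi_sub_mem k (tI (A6 k) q).radical
    (fun i => ⟨q, X_mem_tI _ q i⟩) f
  refine ⟨N0, fun N hN => ?_⟩
  obtain ⟨G, hG⟩ := sub_dvd_pow_sub_pow (C f) (C f - psi k f) N
  refine ⟨G, ?_⟩
  rw [sub_sub_cancel] at hG
  rw [← hG, sub_sub_cancel_left]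
  exact neg_mem ((tI (A6 k) q).pow_mem_of_pow_mem h0 hN)

/-- `F` has degree at most `d` with top-degree part that of `F0`. -/
structure Top {B : Type} [CommRing B] (d : ℕ) (F F0 : A6 B) : Prop where
  h1 : ∀ a : Fin 6 →₀ ℕ, d < a.degree → coeff a F = 0
  h2 : ∀ a : Fin 6 →₀ ℕ, d < a.degree → coeff a F0 = 0
  h3 : ∀ a : Fin 6 →₀ ℕ, a.degree = d → coeff a F = coeff a F0

lemma Top.sub {B : Type} [CommRing B] {d : ℕ} {F F0 G G0 : A6 B} (hF : Top d F F0)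
    (hG : Top d G G0) : Top d (F - G) (F0 - G0) where
  h1 a ha := by rw [coeff_sub, hF.h1 a ha, hG.h1 a ha, sub_zero]
  h2 a ha := by rw [coeff_sub, hF.h2 a ha, hG.h2 a ha, sub_zero]
  h3 a ha := by rw [coeff_sub, hF.h3 a ha, hG.h3 a ha, coeff_sub]

lemma mul_van {B : Type} [CommRing B] {d e : ℕ} {F G : A6 B}
    (hF : ∀ a : Fin 6 →₀ ℕ, d < a.degree → coeff a F = 0)
    (hG : ∀ a : Fin 6 →₀ ℕ, e < a.degree → coeff a G = 0) (a : Fin 6 →₀ ℕ)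
    (ha : d + e < a.degree) : coeff a (F * G) = 0 := by
  rw [coeff_mul]
  refine Finset.sum_eq_zero fun x hx => ?_
  have := congrArg (fun b : Fin 6 →₀ ℕ => b.degree) (Finset.HasAntidiagonal.mem_antidiagonal.1 hx)
  simp only [map_add] at this
  by_cases h : d < x.1.degree
  · rw [hF _ h, zero_mul]
  · rw [hG _ (by omega), mul_zero]

lemma Top.mul {B : Type} [CommRing B] {d e : ℕ} {F F0 G G0 : A6 B} (hF : Top d F F0)
    (hG : Top e G G0) : Top (d + e) (F * G) (F0 * G0) where
  h1 := mul_van hF.h1 hG.h1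
  h2 := mul_van hF.h2 hG.h2
  h3 a ha := by
    rw [coeff_mul, coeff_mul]
    refine Finset.sum_congr rfl fun x hx => ?_
    have := congrArg (fun b : Fin 6 →₀ ℕ => b.degree) (Finset.HasAntidiagonal.mem_antidiagonal.1 hx)
    simp only [map_add] at this
    rcases lt_trichotomy d x.1.degree with h | h | h
    · rw [hF.h1 _ h, hF.h2 _ h, zero_mul, zero_mul]
    · rw [hF.h3 _ h.symm, hG.h3 _ (by omega)]
    · rw [hG.h1 _ (by omega), hG.h2 _ (by omega), mul_zero, mul_zero]

lemma Top.one {B : Type} [CommRing B] : Top 0 (1 : A6 B) 1 where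
  h1 a ha := by
    rw [coeff_one, if_neg]
    rintro rfl
    simp at ha
  h2 a ha := by
    rw [coeff_one, if_neg]
    rintro rfl
    simp at ha
  h3 a ha := rfl

lemma Top.pow {B : Type} [CommRing B] {d : ℕ} {F F0 : A6 B} (hF : Top d F F0) (n : ℕ) :
    Top (n * d) (F ^ n) (F0 ^ n) := by
  induction n with
  | zero => rw [zero_mul, pow_zero, pow_zero]; exact Top.one
  | succ n ih => rw [pow_succ, pow_succ, add_mul, one_mul]; exact ih.mul hF

lemma Top.psiX (k : Type) [CommRing k] (i : Fin 6) : Top 1 (psi k (X i)) (X i) where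
  h1 a ha := by
    classical
    rw [psi_X, coeff_add, coeff_C, coeff_X, if_neg, if_neg, add_zero]
    · rintro rfl
      simp at ha
    · rintro rfl
      simp at ha
  h2 a ha := by
    classical
    rw [coeff_X, if_neg]
    rintro rfl
    simp at ha
  h3 a ha := by
    classical
    rw [psi_X, coeff_add, coeff_C, if_neg, zero_add]
    rintro rfl
    simp at ha

/-- The exponent `(n, …, n)`. -/
noncomputable def cst (n : ℕ) : Fin 6 →₀ ℕ := Finsupp.equivFunOnFinite.symm (fun _ => n)

lemma cst_apply (n : ℕ) (i : Fin 6) : cst n i = n := rfl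

lemma cst_degree (n : ℕ) : (cst n).degree = n * 6 := by
  rw [Finsupp.degree_eq_sum]
  simp [cst_apply, mul_comm]

lemma coeff_prod (B : Type) [CommRing B] (n : ℕ) :
    coeff (cst n) ((X 0 * X 1 * X 2 * X 3 * X 4 * X 5 : A6 B) ^ n) = 1 := by
  have : (X 0 * X 1 * X 2 * X 3 * X 4 * X 5 : A6 B) ^ n = monomial (cst n) 1 := by
    rw [monomial_eq, Finsupp.prod_fintype _ _ (by simp)]
    simp [Fin.prod_univ_six, cst_apply, mul_pow]
  rw [this, coeff_monomial, if_pos rfl]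

lemma coeff_of_mem {B : Type} [CommRing B] {n : ℕ} {F G : A6 B} (h : F - G ∈ tI B (n + 1)) :
    coeff (cst n) F = coeff (cst n) G := by
  rw [← sub_eq_zero, ← coeff_sub]
  exact h _ (fun i => Nat.lt_succ_self n)

/-- If `f ≡ c` modulo `(s, t)` then `(s t f)^n ≡ (s t c)^n` modulo `(s^(n+1), t^(n+1))`. -/
lemma mod_aux {B : Type} [CommRing B] (J : Ideal B) (n : ℕ) (s t f c a b : B)
    (hs : s ^ (n + 1) ∈ J) (ht : t ^ (n + 1) ∈ J) (h : f = c + s * a + t * b) :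
    (s * t * f) ^ n - (s * t * c) ^ n ∈ J := by
  obtain ⟨d, hd⟩ := sub_dvd_pow_sub_pow f c n
  have : (s * t * f) ^ n - (s * t * c) ^ n =
      s ^ (n + 1) * (t ^ n * a * d) + t ^ (n + 1) * (s ^ n * b * d) := by
    rw [mul_pow, mul_pow _ c, ← mul_sub, hd, h]
    ring
  rw [this]
  exact add_mem (Ideal.mul_mem_right _ _ hs) (Ideal.mul_mem_right _ _ ht)

lemma top_D1 (k : Type) [CommRing k] : Top 2 (psi k (D1 k)) (D1 (A6 k)) := by
  unfold D1
  rw [map_sub, map_mul, map_mul]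
  exact ((Top.psiX k _).mul (Top.psiX k _)).sub ((Top.psiX k _).mul (Top.psiX k _))

lemma top_D2 (k : Type) [CommRing k] : Top 2 (psi k (D2 k)) (D2 (A6 k)) := by
  unfold D2
  rw [map_sub, map_mul, map_mul]
  exact ((Top.psiX k _).mul (Top.psiX k _)).sub ((Top.psiX k _).mul (Top.psiX k _))

lemma top_D3 (k : Type) [CommRing k] : Top 2 (psi k (D3 k)) (D3 (A6 k)) := by
  unfold D3
  rw [map_sub, map_mul, map_mul]
  exact ((Top.psiX k _).mul (Top.psiX k _)).sub ((Top.psiX k _).mul (Top.psiX k _))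

lemma coeff1 (k : Type) [CommRing k] (n : ℕ) :
    coeff (cst n) (psi k ((X 1 * X 5 * (D2 k * D3 k)) ^ n)) = 1 := by
  have h := (((Top.psiX k 1).mul (Top.psiX k 5)).mul ((top_D2 k).mul (top_D3 k))).pow n
  rw [← map_mul, ← map_mul, ← map_mul, ← map_pow] at h
  rw [h.h3 _ (cst_degree n), ← coeff_prod (A6 k) n]
  apply coeff_of_mem
  have := mod_aux (tI (A6 k) (n + 1)) n (X 1) (X 5) (D2 (A6 k) * D3 (A6 k))
    (X 0 * X 2 * X 3 * X 4) (- X 2 * X 3 * X 3) (- X 0 * D3 (A6 k)) (X_mem_tI _ _ _)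
    (X_mem_tI _ _ _) (by unfold D2 D3; ring)
  convert this using 2
  ring

lemma coeff2 (k : Type) [CommRing k] (n : ℕ) :
    coeff (cst n) (psi k ((X 0 * X 5 * (D1 k * D3 k)) ^ n)) = 1 := by
  have h := (((Top.psiX k 0).mul (Top.psiX k 5)).mul ((top_D1 k).mul (top_D3 k))).pow n
  rw [← map_mul, ← map_mul, ← map_mul, ← map_pow] at h
  rw [h.h3 _ (cst_degree n), ← coeff_prod (A6 k) n]
  apply coeff_of_mem
  have := mod_aux (tI (A6 k) (n + 1)) n (X 0) (X 5) (D1 (A6 k) * D3 (A6 k))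
    (X 1 * X 2 * X 3 * X 4) (- X 2 * X 4 * X 4) (X 1 * D3 (A6 k)) (X_mem_tI _ _ _)
    (X_mem_tI _ _ _) (by unfold D1 D3; ring)
  convert this using 2
  ring

end Key
end H3

end

section
open MvPolynomial

namespace H3
section Key2
set_option linter.unusedSectionVars false

lemma tI_cancel {B : Type} [CommRing B] [IsDomain B] {q : ℕ} {c : B} (hc : c ≠ 0) {f : A6 B}
    (h : C c * f ∈ tI B q) : f ∈ tI B q := by
  intro a ha
  have := h a ha
  rw [coeff_C_mul] at this
  exact (mul_eq_zero.1 this).resolve_left hc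

variable (p : ℕ) [hp : Fact p.Prime]

lemma frob_mem (e : ℕ) (f : A6 (ZMod p)) :
    C f ^ p ^ e - psi (ZMod p) f ^ p ^ e ∈ tI (A6 (ZMod p)) (p ^ e) := by
  rw [← sub_pow_char_pow]
  exact psi_sub_mem (ZMod p)
    ((tI (A6 (ZMod p)) (p ^ e)).comap (iterateFrobenius (A6 (A6 (ZMod p))) p e))
    (fun i => X_mem_tI _ _ i) f

lemma G_mod (e N : ℕ) (hN : p ^ e ≤ N) (f : A6 (ZMod p)) (hf : f ≠ 0) (G : A6 (A6 (ZMod p)))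
    (hG : psi (ZMod p) f * G - C f ^ N ∈ tI (A6 (ZMod p)) (p ^ e)) :
    G - C (f ^ (N - p ^ e)) * psi (ZMod p) f ^ (p ^ e - 1) ∈ tI (A6 (ZMod p)) (p ^ e) := by
  apply tI_cancel (pow_ne_zero (p ^ e) hf)
  obtain ⟨M, rfl⟩ := Nat.exists_eq_add_of_le hN
  obtain ⟨n, hn⟩ : ∃ n, p ^ e = n + 1 := ⟨p ^ e - 1, by have := pow_pos hp.out.pos e; omega⟩
  have h := frob_mem p e f
  rw [hn] at h hG ⊢
  have : C (f ^ (n + 1)) * (G - C (f ^ (n + 1 + M - (n + 1))) * psi (ZMod p) f ^ (n + 1 - 1)) =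
    (C f ^ (n + 1) - psi (ZMod p) f ^ (n + 1)) * G +
      psi (ZMod p) f ^ n * (psi (ZMod p) f * G - C f ^ (n + 1 + M)) := by
    simp only [Nat.add_sub_cancel_left, Nat.add_sub_cancel, map_pow]
    ring
  rw [this]
  exact add_mem (Ideal.mul_mem_right _ _ h) (Ideal.mul_mem_left _ _ hG)

/-- Reduction modulo `p`. -/
noncomputable def red : A6 ℤ →+* A6 (ZMod p) := map (Int.castRingHom (ZMod p))

/-- Reduction modulo `p` of the coefficients. -/
noncomputable def red2 : A6 (A6 ℤ) →+* A6 (A6 (ZMod p)) := map (red p)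

lemma red_X (i : Fin 6) : red p (X i) = X i := by simp [red]
lemma red_D1 : red p (D1 ℤ) = D1 (ZMod p) := by simp [D1, red_X]
lemma red_D2 : red p (D2 ℤ) = D2 (ZMod p) := by simp [D2, red_X]
lemma red_D3 : red p (D3 ℤ) = D3 (ZMod p) := by simp [D3, red_X]

lemma red_zero (a : A6 ℤ) : red p a = 0 ↔ ∃ b, a = (p : A6 ℤ) * b := by
  have := MvPolynomial.C_dvd_iff_zmod p a
  rw [red, ← this]
  simp only [Dvd.dvd]
  simp

lemma red_surj : Function.Surjective (red p) :=
  map_surjective _ (ZMod.ringHom_surjective _)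

lemma red2_psi (f : A6 ℤ) : red2 p (psi ℤ f) = psi (ZMod p) (red p f) := by
  have : (red2 p).comp (psi ℤ) = (psi (ZMod p)).comp (red p) := by
    apply MvPolynomial.ringHom_ext
    · intro r
      simp
    · intro i
      simp [psi_X, red_X, red2]
  exact DFunLike.congr_fun this f

lemma red2_C (f : A6 ℤ) : red2 p (C f) = C (red p f) := by simp [red2]

lemma red2_mem (q : ℕ) (F : A6 (A6 ℤ)) (h : F ∈ tI (A6 ℤ) q) : red2 p F ∈ tI (A6 (ZMod p)) q := by
  intro a ha
  rw [red2, coeff_map, h a ha, map_zero]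

lemma coeff_red2 (a) (F : A6 (A6 ℤ)) : red p (coeff a F) = coeff a (red2 p F) := by
  rw [red2, coeff_map]

lemma G_red (e N : ℕ) (hN : p ^ e ≤ N) (f : A6 ℤ) (hf : red p f ≠ 0) (G : A6 (A6 ℤ))
    (hG : psi ℤ f * G - C f ^ N ∈ tI (A6 ℤ) (p ^ e)) :
    red2 p G - C (red p f ^ (N - p ^ e)) * psi (ZMod p) (red p f) ^ (p ^ e - 1) ∈
      tI (A6 (ZMod p)) (p ^ e) := by
  apply G_mod p e N hN _ hf
  have := red2_mem p _ _ hG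
  rwa [map_sub, map_mul, red2_psi, map_pow, red2_C] at this

/-- Evaluation modulo `p` of the coefficient attached to a term `a / (f g)`. -/
lemma coeff_main (e N n : ℕ) (hn : p ^ e = n + 1) (hN : p ^ e ≤ N) (f g a b : A6 ℤ)
    (hf : red p f ≠ 0) (hg : red p g ≠ 0)
    (Gf Gg : A6 (A6 ℤ)) (hGf : psi ℤ f * Gf - C f ^ N ∈ tI (A6 ℤ) (p ^ e))
    (hGg : psi ℤ g * Gg - C g ^ N ∈ tI (A6 ℤ) (p ^ e))
    (h1 : coeff (cst n) (psi (ZMod p) ((red p b * (red p f * red p g)) ^ n)) = 1) :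
    ∃ A, coeff (cst n) (psi ℤ (a ^ (n + 1) * b ^ n) * (Gf * Gg)) =
      a ^ (n + 1) * (f * g) ^ (N - (n + 1)) + (p : A6 ℤ) * A := by
  suffices h : red p (coeff (cst n) (psi ℤ (a ^ (n + 1) * b ^ n) * (Gf * Gg)) -
      a ^ (n + 1) * (f * g) ^ (N - (n + 1))) = 0 by
    obtain ⟨A, hA⟩ := (red_zero p _).1 h
    exact ⟨A, by linear_combination hA⟩
  have hf' := G_red p e N hN f hf Gf hGf
  have hg' := G_red p e N hN g hg Gg hGg
  have ha' := frob_mem p e (red p a)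
  rw [hn] at hf' hg' ha'
  rw [map_sub, coeff_red2, sub_eq_zero, map_mul, red2_psi, map_mul (red2 p)]
  set a' := red p a
  set b' := red p b
  set f' := red p f
  set g' := red p g
  simp only [Nat.add_sub_cancel] at hf' hg'
  set J := tI (A6 (ZMod p)) (n + 1)
  have key : psi (ZMod p) (red p (a ^ (n + 1) * b ^ n)) * (red2 p Gf * red2 p Gg) -
      C (a' ^ (n + 1) * (f' * g') ^ (N - (n + 1))) * psi (ZMod p) ((b' * (f' * g')) ^ n) ∈ J := by
    rw [← Ideal.Quotient.eq] at hf' hg' ha' ⊢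
    simp only [map_mul, map_pow] at hf' hg' ha' ⊢
    rw [hf', hg', ← ha']
    ring
  rw [coeff_of_mem key, coeff_C_mul, h1, mul_one]
  simp only [map_mul, map_pow, a', f', g']

theorem key (e : ℕ) (F : A6 ℤ)
    (hF : (p : A6 ℤ) * F = X 0 ^ p ^ e * D1 ℤ ^ p ^ e + X 1 ^ p ^ e * D2 ℤ ^ p ^ e +
      X 2 ^ p ^ e * D3 ℤ ^ p ^ e) :
    ∃ s, ∃ a b c, (D1 ℤ * D2 ℤ * D3 ℤ) ^ s * F =
      D1 ℤ ^ (p ^ e + s) * a + D2 ℤ ^ (p ^ e + s) * b + D3 ℤ ^ (p ^ e + s) * c := by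
  obtain ⟨n, hn⟩ : ∃ n, p ^ e = n + 1 := ⟨p ^ e - 1, by have := pow_pos hp.out.pos e; omega⟩
  obtain ⟨N1, H1⟩ := exists_G ℤ (p ^ e) (D1 ℤ)
  obtain ⟨N2, H2⟩ := exists_G ℤ (p ^ e) (D2 ℤ)
  obtain ⟨N3, H3⟩ := exists_G ℤ (p ^ e) (D3 ℤ)
  obtain ⟨M, hM⟩ : ∃ M, M = N1 + N2 + N3 := ⟨_, rfl⟩
  obtain ⟨G1, hG1⟩ := H1 (p ^ e + M) (by omega)
  obtain ⟨G2, hG2⟩ := H2 (p ^ e + M) (by omega)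
  obtain ⟨G3, hG3⟩ := H3 (p ^ e + M) (by omega)
  have z1 : red p (D1 ℤ) ≠ 0 := by rw [red_D1]; exact D1_ne _
  have z2 : red p (D2 ℤ) ≠ 0 := by rw [red_D2]; exact D2_ne _
  have z3 : red p (D3 ℤ) ≠ 0 := by rw [red_D3]; exact D3_ne _
  obtain ⟨A1, hA1⟩ := coeff_main p e (p ^ e + M) n hn (by omega) (D2 ℤ) (D3 ℤ) (X 0) (X 1 * X 5)
    z2 z3 G2 G3 hG2 hG3 (by
      rw [red_D2, red_D3, map_mul (red p), red_X, red_X]; exact coeff1 _ n)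
  obtain ⟨A2, hA2⟩ := coeff_main p e (p ^ e + M) n hn (by omega) (D1 ℤ) (D3 ℤ) (X 1) (X 0 * X 5)
    z1 z3 G1 G3 hG1 hG3 (by
      rw [red_D1, red_D3, map_mul (red p), red_X, red_X]; exact coeff2 _ n)
  set P : A6 (A6 ℤ) := psi ℤ ((X 0 * X 1 * X 5) ^ n)
  set c3 := coeff (cst n) (psi ℤ (X 2 * (X 0 * X 1 * X 5) ^ n) * (G1 * G2))
  rw [hn] at hF hG1 hG2 hG3 hA1 hA2 ⊢
  rw [Nat.add_sub_cancel_left] at hA1 hA2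
  have tot : D1 ℤ ^ (n + 1 + M) * (X 0 ^ (n + 1) * (D2 ℤ * D3 ℤ) ^ M + (p : A6 ℤ) * A1) +
      D2 ℤ ^ (n + 1 + M) * (X 1 ^ (n + 1) * (D1 ℤ * D3 ℤ) ^ M + (p : A6 ℤ) * A2) +
      D3 ℤ ^ (n + 1 + M) * c3 = 0 := by
    rw [← hA1, ← hA2, ← coeff_C_mul, ← coeff_C_mul, ← coeff_C_mul, ← coeff_add, ← coeff_add,
      ← coeff_zero (cst n)]
    apply coeff_of_mem
    have hrel := congrArg (psi ℤ) (rel1 ℤ)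
    rw [← Ideal.Quotient.eq] at hG1 hG2 hG3 ⊢
    simp only [map_mul, map_pow, map_add, map_zero] at hG1 hG2 hG3 hrel ⊢
    rw [← hG1, ← hG2, ← hG3]
    have hrel2 := congrArg (Ideal.Quotient.mk (tI (A6 ℤ) (n + 1))) hrel
    simp only [map_mul, map_add, map_zero] at hrel2
    set φ := Ideal.Quotient.mk (tI (A6 ℤ) (n + 1))
    linear_combination φ G1 * φ G2 * φ G3 * (φ (psi ℤ (X 0)) * φ (psi ℤ (X 1)) *
      φ (psi ℤ (X 5))) ^ n * hrel2
  obtain ⟨A3, hA3⟩ : ∃ A3, c3 = X 2 ^ (n + 1) * (D1 ℤ * D2 ℤ) ^ M + (p : A6 ℤ) * A3 := by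
    suffices h : red p (c3 - X 2 ^ (n + 1) * (D1 ℤ * D2 ℤ) ^ M) = 0 by
      obtain ⟨A, hA⟩ := (red_zero p _).1 h
      exact ⟨A, by linear_combination hA⟩
    have h2 : red p (D3 ℤ ^ (n + 1 + M) * (c3 - X 2 ^ (n + 1) * (D1 ℤ * D2 ℤ) ^ M)) = 0 := by
      refine (red_zero p _).2 ⟨- (D1 ℤ ^ (n + 1 + M) * A1) - D2 ℤ ^ (n + 1 + M) * A2 -
        (D1 ℤ * D2 ℤ * D3 ℤ) ^ M * F, ?_⟩
      linear_combination tot + (D1 ℤ * D2 ℤ * D3 ℤ) ^ M * hF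
    rw [map_mul, map_pow] at h2
    exact (mul_eq_zero.1 h2).resolve_left (pow_ne_zero _ z3)
  refine ⟨M, -A1, -A2, -A3, ?_⟩
  have hp0 : (p : A6 ℤ) ≠ 0 := by exact_mod_cast hp.out.ne_zero
  apply mul_left_cancel₀ hp0
  rw [hA3] at tot
  linear_combination (D1 ℤ * D2 ℤ * D3 ℤ) ^ M * hF + tot
end Key2
end H3

end

section
open MvPolynomial

namespace H3
section Fin
variable (p : ℕ) [hp : Fact p.Prime]

/-- The row swap. -/
noncomputable def swp : A6 ℤ →ₐ[ℤ] A6 ℤ := rename (fun i => i + 3)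

lemma swp_swp (f : A6 ℤ) : swp (swp f) = f := by
  rw [swp, rename_rename]
  have : ((fun i : Fin 6 => i + 3) ∘ fun i => i + 3) = id := by decide
  rw [this, rename_id_apply]

lemma swp_D1 : swp (D1 ℤ) = - D1 ℤ := by
  have e : ((1 : Fin 6) + 3 = 4) ∧ ((5 : Fin 6) + 3 = 2) ∧ ((2 : Fin 6) + 3 = 5) ∧
    ((4 : Fin 6) + 3 = 1) := by decide
  simp only [D1, swp, map_sub, map_mul, rename_X, e.1, e.2.1, e.2.2.1, e.2.2.2]
  ring

lemma swp_D2 : swp (D2 ℤ) = - D2 ℤ := by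
  have e : ((2 : Fin 6) + 3 = 5) ∧ ((3 : Fin 6) + 3 = 0) ∧ ((0 : Fin 6) + 3 = 3) ∧
    ((5 : Fin 6) + 3 = 2) := by decide
  simp only [D2, swp, map_sub, map_mul, rename_X, e.1, e.2.1, e.2.2.1, e.2.2.2]
  ring

lemma swp_D3 : swp (D3 ℤ) = - D3 ℤ := by
  have e : ((0 : Fin 6) + 3 = 3) ∧ ((4 : Fin 6) + 3 = 1) ∧ ((1 : Fin 6) + 3 = 4) ∧
    ((3 : Fin 6) + 3 = 0) := by decide
  simp only [D3, swp, map_sub, map_mul, rename_X, e.1, e.2.1, e.2.2.1, e.2.2.2]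
  ring

theorem key' (e : ℕ) (F : A6 ℤ)
    (hF : (p : A6 ℤ) * F = X 3 ^ p ^ e * D1 ℤ ^ p ^ e + X 4 ^ p ^ e * D2 ℤ ^ p ^ e +
      X 5 ^ p ^ e * D3 ℤ ^ p ^ e) :
    ∃ s, ∃ a b c, (D1 ℤ * D2 ℤ * D3 ℤ) ^ s * F =
      D1 ℤ ^ (p ^ e + s) * a + D2 ℤ ^ (p ^ e + s) * b + D3 ℤ ^ (p ^ e + s) * c := by
  have x3 : swp (X 3) = X 0 := by rw [swp, rename_X]; rfl
  have x4 : swp (X 4) = X 1 := by rw [swp, rename_X]; rfl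
  have x5 : swp (X 5) = X 2 := by rw [swp, rename_X]; rfl
  have sgn : ∀ n : ℕ, ((-1 : A6 ℤ) ^ n) * (-1) ^ n = 1 := fun n => by
    rw [← mul_pow]; simp
  have sgn2 : ∀ (n : ℕ) (a : A6 ℤ), (-a) ^ n = (-1) ^ n * a ^ n := fun n a => neg_pow a n
  have h := congrArg swp hF
  simp only [map_mul, map_add, map_pow, map_natCast, swp_D1, swp_D2, swp_D3, x3, x4, x5] at h
  obtain ⟨s, a, b, c, hs⟩ := key p e ((-1) ^ p ^ e * swp F) (by
    rw [sgn2 _ (D1 ℤ), sgn2 _ (D2 ℤ), sgn2 _ (D3 ℤ)] at h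
    linear_combination (-1) ^ p ^ e * h + (X 0 ^ p ^ e * D1 ℤ ^ p ^ e + X 1 ^ p ^ e * D2 ℤ ^ p ^ e +
      X 2 ^ p ^ e * D3 ℤ ^ p ^ e) * sgn (p ^ e))
  have h2 := congrArg swp hs
  simp only [map_mul, map_add, map_pow, map_neg, map_one, swp_D1, swp_D2, swp_D3, swp_swp] at h2
  have e3 : -D1 ℤ * -D2 ℤ * -D3 ℤ = - (D1 ℤ * D2 ℤ * D3 ℤ) := by ring
  rw [e3, sgn2, sgn2 _ (D1 ℤ), sgn2 _ (D2 ℤ), sgn2 _ (D3 ℤ)] at h2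
  refine ⟨s, swp a, swp b, swp c, ?_⟩
  have h3 := sgn (p ^ e + s)
  rw [← one_mul ((D1 ℤ * D2 ℤ * D3 ℤ) ^ s * F), ← h3]
  have h4 := congrArg (fun r => (-1) ^ (p ^ e + s) * r) h2
  linear_combination h4 + (D1 ℤ ^ (p ^ e + s) * swp a + D2 ℤ ^ (p ^ e + s) * swp b +
    D3 ℤ ^ (p ^ e + s) * swp c) * h3

lemma exists_F (e : ℕ) (a b c : A6 ℤ) (h : a * D1 ℤ + b * D2 ℤ + c * D3 ℤ = 0) :
    ∃ F, a ^ p ^ e * D1 ℤ ^ p ^ e + b ^ p ^ e * D2 ℤ ^ p ^ e + c ^ p ^ e * D3 ℤ ^ p ^ e =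
      (p : A6 ℤ) * F := by
  rw [← red_zero]
  have h2 := congrArg (fun r => red p r ^ p ^ e) h
  simp only [map_add, map_zero] at h2
  rw [add_pow_char_pow, add_pow_char_pow, zero_pow (pow_pos hp.out.pos e).ne'] at h2
  rw [← h2]
  simp only [map_mul, map_add, map_pow, mul_pow]

lemma tors_R (t : ℕ) (m a b c : A6 ℤ)
    (h : (p : A6 ℤ) * m = D1 ℤ ^ t * a + D2 ℤ ^ t * b + D3 ℤ ^ t * c) :
    ∃ s, ∃ a b c : A6 ℤ, (D1 ℤ * D2 ℤ * D3 ℤ) ^ s * m =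
      D1 ℤ ^ (t + s) * a + D2 ℤ ^ (t + s) * b + D3 ℤ ^ (t + s) * c := by
  obtain ⟨r, hr⟩ := Nat.exists_eq_add_of_le (Nat.lt_pow_self (n := t) hp.out.one_lt).le
  obtain ⟨F1, hF1⟩ := exists_F p t _ _ _ (rel1 ℤ)
  obtain ⟨F2, hF2⟩ := exists_F p t _ _ _ (rel2 ℤ)
  obtain ⟨s1, a1, b1, c1, k1⟩ := key p t F1 hF1.symm
  obtain ⟨s2, a2, b2, c2, k2⟩ := key' p t F2 hF2.symm
  let a' := a * (D2 ℤ * D3 ℤ) ^ r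
  let b' := b * (D1 ℤ * D3 ℤ) ^ r
  let c' := c * (D1 ℤ * D2 ℤ) ^ r
  have h' : (p : A6 ℤ) * ((D1 ℤ * D2 ℤ * D3 ℤ) ^ r * m) =
      a' * D1 ℤ ^ p ^ t + b' * D2 ℤ ^ p ^ t + c' * D3 ℤ ^ p ^ t := by
    rw [hr]
    simp only [a', b', c']
    linear_combination (D1 ℤ * D2 ℤ * D3 ℤ) ^ r * h
  have h'' := (red_zero p _).2 ⟨_, h'.symm⟩
  simp only [map_add, map_mul, map_pow, red_D1, red_D2, red_D3] at h''
  obtain ⟨α, β, g1, g2, g3⟩ := syz p t _ _ _ h''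
  obtain ⟨α, rfl⟩ := red_surj p α
  obtain ⟨β, rfl⟩ := red_surj p β
  have lift : ∀ (g : A6 ℤ) (i j : Fin 6), red p g =
      red p α * X i ^ p ^ t + red p β * X j ^ p ^ t → ∃ d, g =
      α * X i ^ p ^ t + β * X j ^ p ^ t + (p : A6 ℤ) * d := by
    intro g i j hg
    obtain ⟨d, hd⟩ := (red_zero p (g - (α * X i ^ p ^ t + β * X j ^ p ^ t))).1 (by
      simp only [map_sub, map_add, map_mul, map_pow, red_X]
      rw [hg, sub_self])
    exact ⟨d, by linear_combination hd⟩
  obtain ⟨d1, j1⟩ := lift a' _ _ (by rw [← g1])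
  obtain ⟨d2, j2⟩ := lift b' _ _ (by rw [← g2])
  obtain ⟨d3, j3⟩ := lift c' _ _ (by rw [← g3])
  have hp0 : (p : A6 ℤ) ≠ 0 := by exact_mod_cast hp.out.ne_zero
  have main : (D1 ℤ * D2 ℤ * D3 ℤ) ^ r * m =
      α * F1 + β * F2 + d1 * D1 ℤ ^ p ^ t + d2 * D2 ℤ ^ p ^ t + d3 * D3 ℤ ^ p ^ t := by
    apply mul_left_cancel₀ hp0
    rw [h', j1, j2, j3]
    linear_combination α * hF1 + β * hF2
  let d := D1 ℤ * D2 ℤ * D3 ℤ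
  refine ⟨r + (s1 + s2),
    α * a1 * (D2 ℤ * D3 ℤ) ^ s2 + β * a2 * (D2 ℤ * D3 ℤ) ^ s1 + d1 * (D2 ℤ * D3 ℤ) ^ (s1 + s2),
    α * b1 * (D1 ℤ * D3 ℤ) ^ s2 + β * b2 * (D1 ℤ * D3 ℤ) ^ s1 + d2 * (D1 ℤ * D3 ℤ) ^ (s1 + s2),
    α * c1 * (D1 ℤ * D2 ℤ) ^ s2 + β * c2 * (D1 ℤ * D2 ℤ) ^ s1 + d3 * (D1 ℤ * D2 ℤ) ^ (s1 + s2), ?_⟩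
  have ht : t + (r + (s1 + s2)) = p ^ t + s1 + s2 := by omega
  rw [ht]
  generalize p ^ t = q at *
  linear_combination (D1 ℤ * D2 ℤ * D3 ℤ) ^ (s1 + s2) * main +
    α * (D1 ℤ * D2 ℤ * D3 ℤ) ^ s2 * k1 + β * (D1 ℤ * D2 ℤ * D3 ℤ) ^ s1 * k2

theorem bij_prime (I : Ideal (A6 ℤ)) (hI : I = Ideal.span {D1 ℤ, D2 ℤ, D3 ℤ}) :
    Function.Bijective (fun m : (localCohomology I 3).obj (ModuleCat.of (A6 ℤ) (A6 ℤ)) =>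
      (p : ℤ) • m) := by
  letI : Algebra (A6 ℤ) (A6 (ZMod p)) := (red p).toAlgebra
  have hal : ∀ a, algebraMap (A6 ℤ) (A6 (ZMod p)) a = red p a := fun _ => rfl
  have hp0 : (p : A6 ℤ) ≠ 0 := by exact_mod_cast hp.out.ne_zero
  refine bij_of_facts (S := A6 (ZMod p)) (D1 ℤ) (D2 ℤ) (D3 ℤ) I hI (p : ℤ) ?_ (red_surj p) ?_ ?_
    (D1_cancel ℤ) ?_ ?_ ?_ ?_
  · intro a ha
    rw [Int.cast_natCast] at ha
    exact (mul_eq_zero.1 ha).resolve_left hp0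
  · intro a
    rw [hal, red_zero, Int.cast_natCast]
  · intro m hm
    exact (mul_eq_zero.1 hm).resolve_left (D1_ne ℤ)
  · intro m hm
    rw [hal, red_D1] at hm
    exact (mul_eq_zero.1 hm).resolve_left (D1_ne _)
  · intro m b hm
    rw [hal, hal, red_D1, red_D2] at hm
    rw [hal, red_D1]
    exact D1_cancel _ m b hm
  · intro t m a b c h
    rw [Int.cast_natCast] at h
    exact tors_R p t m a b c h
  · intro t m
    simp only [hal, map_mul, red_D1, red_D2, red_D3]
    exact vanish_S p t m

end Fin

theorem bij_all (I : Ideal (A6 ℤ)) (hI : I = Ideal.span {D1 ℤ, D2 ℤ, D3 ℤ}) (n : ℤ) (hn : n ≠ 0) :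
    Function.Bijective (fun m : (localCohomology I 3).obj (ModuleCat.of (A6 ℤ) (A6 ℤ)) =>
      n • m) := by
  have hnat : ∀ k : ℕ, k ≠ 0 → Function.Bijective
      (fun m : (localCohomology I 3).obj (ModuleCat.of (A6 ℤ) (A6 ℤ)) => (k : ℤ) • m) := by
    intro k
    induction k using induction_on_primes with
    | zero => intro h; exact absurd rfl h
    | one =>
      intro _
      simp only [Nat.cast_one, one_smul]
      exact Function.bijective_id
    | prime_mul q a hq ih =>
      intro h
      haveI : Fact q.Prime := ⟨hq⟩
      have h1 := bij_prime q I hI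
      have h2 := ih (by rintro rfl; simp at h)
      have h3 := h1.comp h2
      convert h3 using 2 with m
      simp only [Function.comp_apply, smul_smul, Nat.cast_mul]
  obtain ⟨k, rfl | rfl⟩ := n.eq_nat_or_neg
  · exact hnat k (by simpa using hn)
  · have h := hnat k (by simpa using hn)
    have h2 := (Equiv.neg ((localCohomology I 3).obj
      (ModuleCat.of (A6 ℤ) (A6 ℤ)))).bijective.comp h
    convert h2 using 2 with m
    simp only [Function.comp_apply, Equiv.neg_apply, neg_smul]
end H3

end

/-- Multiplication by any nonzero integer `n` is bijective on `H³_I(R)`; thus `H³_I(R)` is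
a uniquely divisible abelian group, i.e. a rational vector space. -/
theorem third_local_cohomology_rational_vector_space (n : ℤ) (hn : n ≠ 0) :
    Function.Bijective
      (fun m : (localCohomology I23 3).obj
          (ModuleCat.of (MvPolynomial (Fin 6) ℤ) (MvPolynomial (Fin 6) ℤ)) =>
        n • m) := by
  exact H3.bij_all I23 rfl n hn
end

section
/- Let p be a prime and R̄ = (ℤ/pℤ)[u,v,w,x,y,z]. Every triple (a, b, c) ∈ R̄³ satisfying a·Δ1 + b·Δ2 + c·Δ3 = 0 is an R̄-linear combination of the two triples (u, v, w) and (x, y, z); that is, the syzygy module of (Δ1, Δ2, Δ3) is generated by the two rows of the generic matrix. In particular, the Koszul cohomology module H²(Δ1, Δ2, Δ3; R̄) is generated as an R̄-module by the classes corresponding to the relations u·Δ1 + v·Δ2 + w·Δ3 = 0 and x·Δ1 + y·Δ2 + z·Δ3 = 0. -/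
open MvPolynomial

/-- Over `R̄ = (ℤ/pℤ)[u,v,w,x,y,z]`, every syzygy of the minors `Δ1, Δ2, Δ3` of the generic
`2 × 3` matrix is an `R̄`-linear combination of the two rows `(u, v, w)` and `(x, y, z)`. -/
theorem syzygies_of_minors (p : ℕ) (hp : p.Prime)
    (u v w x y z Δ1 Δ2 Δ3 : MvPolynomial (Fin 6) (ZMod p))
    (hu : u = X 0) (hv : v = X 1) (hw : w = X 2)
    (hx : x = X 3) (hy : y = X 4) (hz : z = X 5)
    (h1 : Δ1 = v * z - w * y) (h2 : Δ2 = w * x - u * z) (h3 : Δ3 = u * y - v * x)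
    (a b c : MvPolynomial (Fin 6) (ZMod p))
    (hrel : a * Δ1 + b * Δ2 + c * Δ3 = 0) :
    ∃ r s : MvPolynomial (Fin 6) (ZMod p),
      a = r * u + s * x ∧ b = r * v + s * y ∧ c = r * w + s * z := by
  have : Fact p.Prime := ⟨hp⟩
  have hvars : ∀ i : Fin 6, i ≠ 1 → i ≠ 3 →
      i ∉ (-(X 1 * X 3) : MvPolynomial (Fin 6) (ZMod p)).vars := by
    intro i h1 h3 hi
    rw [vars_neg] at hi
    have := vars_mul _ _ hi
    simp [vars_X, h1, h3] at this
  have hX : Irreducible (X 0 : MvPolynomial (Fin 6) (ZMod p)) := by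
    have h := irreducible_mul_X_add (1 : MvPolynomial (Fin 6) (ZMod p)) 0 0
      one_ne_zero (by simp) (by simp) isRelPrime_one_left
    simpa using h
  have hirr : Irreducible Δ3 := by
    have h := irreducible_mul_X_add (X 0 : MvPolynomial (Fin 6) (ZMod p)) (-(X 1 * X 3)) 4
      (X_ne_zero _) (by simp [vars_X]) (hvars 4 (by decide) (by decide)) (by
        refine (hX.isRelPrime_iff_not_dvd).2 ?_
        rintro ⟨q, hq⟩
        have := congrArg (eval ![0, 1, 0, 1, 0, 0]) hq
        simp at this)
    have e : Δ3 = X 0 * X 4 + -(X 1 * X 3) := by rw [h3, hu, hv, hx, hy]; ring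
    rw [e]; exact h
  have hprime : Prime Δ3 := hirr.prime
  have hnd : ¬ Δ3 ∣ Δ1 := by
    rintro ⟨q, hq⟩
    rw [h1, h3, hu, hv, hw, hx, hy, hz] at hq
    have := congrArg (eval ![0, 1, 0, 0, 0, 1]) hq
    simp at this
  have hr : Δ3 ∣ a * y - b * x := by
    refine (hprime.dvd_or_dvd (b := Δ1) ⟨b * z - y * c, ?_⟩).resolve_right hnd
    subst h1 h2 h3
    linear_combination y * hrel
  have hs : Δ3 ∣ u * b - v * a := by
    refine (hprime.dvd_or_dvd (b := Δ1) ⟨v * c - b * w, ?_⟩).resolve_right hnd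
    subst h1 h2 h3
    linear_combination - v * hrel
  obtain ⟨r, hr⟩ := hr
  obtain ⟨s, hs⟩ := hs
  refine ⟨r, s, ?_, ?_, ?_⟩ <;> apply mul_left_cancel₀ hprime.ne_zero
  · linear_combination u * hr + x * hs + a * h3
  · linear_combination v * hr + y * hs + b * h3
  · linear_combination hrel + w * hr + z * hs - a * h1 - b * h2
end

section
/- Let p be a prime, q = p^e for some e ≥ 0, and k = q − 1. Let G ∈ ℤ[u,v,w,x,y,z] be the polynomial obtained by applying the k-th iterated partial derivative with respect to z, then with respect to y, then with respect to u, to the polynomial v·Δ3^k·Δ1^k. Then there exists a (necessarily unique) polynomial Q ∈ ℤ[u,v,w,x,y,z] such that (k!)^3·Q = G, and Q ≡ v^q modulo p. (That is, the divided-power operator D = (1/k!)∂^k/∂u^k · (1/k!)∂^k/∂y^k · (1/k!)∂^k/∂z^k satisfies D(v·Δ3^{q−1}·Δ1^{q−1}) ≡ v^q mod p.) -/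
open MvPolynomial

lemma iterate_derivation_mul_pow (i : Fin 6) (t a : MvPolynomial (Fin 6) ℤ)
    (ht : pderiv i t = a) (ha : pderiv i a = 0) (k : ℕ) :
    ∀ c : MvPolynomial (Fin 6) ℤ, pderiv i c = 0 → (⇑(pderiv i))^[k] (c * t ^ k) = (k.factorial : MvPolynomial (Fin 6) ℤ) * a ^ k * c := by
  induction k with
  | zero => intro c _; simp
  | succ k ih =>
    intro c hc
    have h1 : pderiv i (c * t ^ (k + 1)) = (((k + 1 : ℕ) : MvPolynomial (Fin 6) ℤ) * c * a) * t ^ k := by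
      simp only [Derivation.leibniz, Derivation.leibniz_pow, hc, ht, smul_eq_mul, nsmul_eq_mul,
        Nat.add_sub_cancel]
      ring
    have h2 : pderiv i (((k + 1 : ℕ) : MvPolynomial (Fin 6) ℤ) * c * a) = 0 := by
      simp [Derivation.leibniz, hc, ha]
    rw [Function.iterate_succ_apply, h1, ih _ h2, Nat.factorial_succ]
    push_cast
    ring

/-- With `q = p^e`, `k = q - 1`, and `G = ∂u^k ∂y^k ∂z^k (v Δ3^k Δ1^k)`, there is a unique
polynomial `Q` with `(k!)^3 • Q = G`, and `Q ≡ v^q mod p`. -/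
theorem divided_power_operator_on_second_term (p : ℕ) (hp : p.Prime) (e : ℕ)
    (q k : ℕ) (hq : q = p ^ e) (hk : k = q - 1)
    (G : MvPolynomial (Fin 6) ℤ)
    (hG : G = (⇑(pderiv (0 : Fin 6)))^[k] ((⇑(pderiv (4 : Fin 6)))^[k]
      ((⇑(pderiv (5 : Fin 6)))^[k] (V * Δ3 ^ k * Δ1 ^ k)))) :
    ∃! Q : MvPolynomial (Fin 6) ℤ,
      ((k.factorial ^ 3 : ℕ) : ℤ) • Q = G ∧
        ∀ d : Fin 6 →₀ ℕ, ((p : ℤ)) ∣ (Q - V ^ q).coeff d := by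
  have hq0 : 0 < q := hq ▸ pow_pos hp.pos e
  have hkq : k + 1 = q := by omega
  have hGV : G = ((k.factorial ^ 3 : ℕ) : ℤ) • V ^ q := by
    have e1 := iterate_derivation_mul_pow (5 : Fin 6) Δ1 V
      (by simp [Δ1, V, W, Yy, Zz, pderiv_X, Derivation.leibniz])
      (by simp [V, pderiv_X]) k (V * Δ3 ^ k)
      (by simp [Δ3, U, V, Xx, Yy, pderiv_X, Derivation.leibniz, Derivation.leibniz_pow])
    have e2 := iterate_derivation_mul_pow (4 : Fin 6) Δ3 U
      (by simp [Δ3, U, V, Xx, Yy, pderiv_X, Derivation.leibniz])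
      (by simp [U, pderiv_X]) k ((k.factorial : MvPolynomial (Fin 6) ℤ) * V ^ k * V)
      (by simp [V, pderiv_X, Derivation.leibniz, Derivation.leibniz_pow])
    have e3 := iterate_derivation_mul_pow (0 : Fin 6) U 1
      (by simp [U]) (by simp) k
      ((k.factorial : MvPolynomial (Fin 6) ℤ) * (k.factorial * V ^ k * V))
      (by simp [V, pderiv_X, Derivation.leibniz, Derivation.leibniz_pow])
    rw [hG, e1, show (k.factorial : MvPolynomial (Fin 6) ℤ) * V ^ k * (V * Δ3 ^ k)
      = (k.factorial * V ^ k * V) * Δ3 ^ k by ring, e2,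
      show (k.factorial : MvPolynomial (Fin 6) ℤ) * U ^ k * (k.factorial * V ^ k * V)
      = ((k.factorial : MvPolynomial (Fin 6) ℤ) * (k.factorial * V ^ k * V)) * U ^ k by ring, e3,
      ← hkq, zsmul_eq_mul]
    push_cast
    ring
  refine ⟨V ^ q, ⟨hGV.symm, fun d => by simp⟩, ?_⟩
  rintro Q ⟨hQ, -⟩
  have hne : ((k.factorial ^ 3 : ℕ) : ℤ) ≠ 0 := by
    exact_mod_cast pow_ne_zero 3 k.factorial_ne_zero
  exact smul_right_injective _ hne (hQ.trans hGV)
end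

section
/- Let p be a prime, q = p^e for some e ≥ 0, and k = q − 1. Let H ∈ ℤ[u,v,w,x,y,z] be the polynomial obtained by applying the k-th iterated partial derivative with respect to z, then with respect to y, then with respect to u, to the polynomial w·Δ1^k·Δ2^k. Then there exists a (necessarily unique) polynomial S ∈ ℤ[u,v,w,x,y,z] such that (k!)^3·S = H, and S ≡ w^q modulo p. (That is, the divided-power operator D = (1/k!)∂^k/∂u^k · (1/k!)∂^k/∂y^k · (1/k!)∂^k/∂z^k satisfies D(w·Δ1^{q−1}·Δ2^{q−1}) ≡ w^q mod p.) -/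
open MvPolynomial

open MvPolynomial

/-- Iterating a derivation `k` times on `c * f ^ k`, with `c` and `D f = d` constants for `D`. -/
lemma iterate_derivation_mul_pow_s14 {A R : Type*} [CommRing A] [CommRing R] [Algebra A R]
    (D : Derivation A R R) (f d : R)
    (hf : D f = d) (hd : D d = 0) (k : ℕ) :
    ∀ c : R, D c = 0 → (⇑D)^[k] (c * f ^ k) = (k.factorial : R) * c * d ^ k := by
  induction k with
  | zero => intro c _; simp
  | succ n ih =>
    intro c hc
    have h1 : D (c * f ^ (n + 1)) = (((n + 1 : ℕ) : R) * c * d) * f ^ n := by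
      rw [Derivation.leibniz, Derivation.leibniz_pow, hc, hf]
      simp only [smul_eq_mul, nsmul_eq_mul, Nat.add_sub_cancel]
      ring
    have h2 : D (((n + 1 : ℕ) : R) * c * d) = 0 := by
      simp [Derivation.leibniz, hc, hd]
    rw [Function.iterate_succ_apply, h1, ih _ h2, Nat.factorial_succ]
    push_cast
    ring

lemma pderiv_commute (i j : Fin 6) :
    Function.Commute (⇑(pderiv i : Derivation ℤ (MvPolynomial (Fin 6) ℤ) _))
      (⇑(pderiv j : Derivation ℤ (MvPolynomial (Fin 6) ℤ) _)) := by
  intro x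
  have h : ⁅(pderiv i : Derivation ℤ (MvPolynomial (Fin 6) ℤ) (MvPolynomial (Fin 6) ℤ)),
      (pderiv j : Derivation ℤ (MvPolynomial (Fin 6) ℤ) (MvPolynomial (Fin 6) ℤ))⁆ = 0 := by
    apply MvPolynomial.derivation_ext
    intro l
    simp [Derivation.commutator_apply, pderiv_X, Pi.single_apply, apply_ite]
  have h2 := congrArg (fun D => D x) h
  simpa [Derivation.commutator_apply, sub_eq_zero] using h2

lemma main_computation (k : ℕ) :
    (⇑(pderiv (0 : Fin 6)))^[k] ((⇑(pderiv (4 : Fin 6)))^[k]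
      ((⇑(pderiv (5 : Fin 6)))^[k] (W * Δ1 ^ k * Δ2 ^ k)))
      = (k.factorial : MvPolynomial (Fin 6) ℤ) ^ 3 * W ^ (k + 1) := by
  rw [((pderiv_commute 4 5).iterate_iterate k k).eq,
    ((pderiv_commute 0 5).iterate_iterate k k).eq]
  have e1 : W * Δ1 ^ k * Δ2 ^ k = (W * Δ2 ^ k) * Δ1 ^ k := by ring
  rw [e1, iterate_derivation_mul_pow_s14 (pderiv (4 : Fin 6)) Δ1 (-W)
    (by simp [Δ1, V, W, Yy, Zz, pderiv_X, Derivation.leibniz, Pi.single_apply])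
    (by simp [W, pderiv_X, Pi.single_apply]) k _
    (by simp [Δ2, U, W, Xx, Zz, pderiv_X, Derivation.leibniz, Derivation.leibniz_pow,
      Pi.single_apply])]
  have e2 : (k.factorial : MvPolynomial (Fin 6) ℤ) * (W * Δ2 ^ k) * (-W) ^ k
      = ((k.factorial : MvPolynomial (Fin 6) ℤ) * W * (-W) ^ k) * Δ2 ^ k := by ring
  rw [e2, iterate_derivation_mul_pow_s14 (pderiv (0 : Fin 6)) Δ2 (-Zz)
    (by simp [Δ2, U, W, Xx, Zz, pderiv_X, Derivation.leibniz, Pi.single_apply])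
    (by simp [Zz, pderiv_X, Pi.single_apply]) k _
    (by simp [W, pderiv_X, Derivation.leibniz, Derivation.leibniz_pow, Pi.single_apply])]
  rw [iterate_derivation_mul_pow_s14 (pderiv (5 : Fin 6)) (-Zz) (-1)
    (by simp [Zz, pderiv_X, Pi.single_apply])
    (by simp) k _
    (by simp [W, pderiv_X, Derivation.leibniz, Derivation.leibniz_pow, Pi.single_apply])]
  have e3 : (-W) ^ k * (-1) ^ k = W ^ k := by rw [← mul_pow]; simp
  calc _ = (k.factorial : MvPolynomial (Fin 6) ℤ) ^ 3 * W * ((-W) ^ k * (-1) ^ k) := by ring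
    _ = _ := by rw [e3]; ring

/-- With `q = p^e`, `k = q - 1`, and `H = ∂u^k ∂y^k ∂z^k (w Δ1^k Δ2^k)`, there is a unique
polynomial `S` with `(k!)^3 • S = H`, and `S ≡ w^q mod p`. -/
theorem divided_power_operator_on_third_term (p : ℕ) (hp : p.Prime) (e : ℕ)
    (q k : ℕ) (hq : q = p ^ e) (hk : k = q - 1)
    (H : MvPolynomial (Fin 6) ℤ)
    (hH : H = (⇑(pderiv (0 : Fin 6)))^[k] ((⇑(pderiv (4 : Fin 6)))^[k]
      ((⇑(pderiv (5 : Fin 6)))^[k] (W * Δ1 ^ k * Δ2 ^ k)))) :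
    ∃! S : MvPolynomial (Fin 6) ℤ,
      ((k.factorial ^ 3 : ℕ) : ℤ) • S = H ∧
        ∀ d : Fin 6 →₀ ℕ, ((p : ℤ)) ∣ (S - W ^ q).coeff d := by
  have hq1 : k + 1 = q := by
    have : 0 < q := hq ▸ pow_pos hp.pos e
    omega
  have hH2 : ((k.factorial ^ 3 : ℕ) : ℤ) • (W ^ q) = H := by
    rw [hH, main_computation, hq1, zsmul_eq_mul]
    push_cast
    rfl
  refine ⟨W ^ q, ⟨hH2, fun d => by simp⟩, ?_⟩
  rintro T ⟨hT, -⟩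
  have hne : ((k.factorial ^ 3 : ℕ) : ℤ) ≠ 0 := by
    exact_mod_cast pow_ne_zero 3 (Nat.factorial_ne_zero k)
  exact smul_right_injective _ hne (hT.trans hH2.symm)
end
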